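/- Let n ∈ ℕ, k ∈ ℕ∪{0}, let 1 < p ≤ q < ∞ with 0 ≤ 1/p − 1/q ≤ 1/n, let η > 0, and assume a > 1. Then there exists a constant C > 0 such that for every u ∈ C_c^∞(B_η∖{0}), ∫_{B_η} |∇u(x)|^p w^{sl}_{k,1}(|x|)^{p−1} |x|^{1−n} dx ≥ C · ( ∫_{B_η} |u(x)|^q |x|^{1−n} / ( w^{sl}_{k,1}(|x|) · A^1_{k+1}(η/|x|)^{1+q/p'} ) dx )^{p/q}. -/

import Mathlib

open Real MeasureTheory Filter Topology Set

/-- `F(u) = a - log a + log u`. -/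
noncomputable def Fa (a : ℝ) : ℝ → ℝ := fun u => a - Real.log a + Real.log u

/-- `F̃(u) = a · ∏_{k=0}^∞ (F^k(u)/a)`. -/
noncomputable def Ftilde (a : ℝ) (u : ℝ) : ℝ := a * ∏' k : ℕ, ((Fa a)^[k] u / a)

/-- `φ(u) = a + ∫_a^u dt / F̃(t)`. -/
noncomputable def phiFun (a : ℝ) (u : ℝ) : ℝ := a + ∫ t in a..u, 1 / Ftilde a t

/-- The super-logarithm: `L(r) = φ(ar) - a` for `r ≥ 1` and `L(r) = -L(1/r)` for `0 < r < 1`. -/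
noncomputable def superLog (a : ℝ) (r : ℝ) : ℝ :=
  if 1 ≤ r then phiFun a (a * r) - a else -(phiFun a (a * (1 / r)) - a)

/-- `A^0_k(r) = F^k(ar)`. -/
noncomputable def A0 (a : ℝ) (k : ℕ) (r : ℝ) : ℝ := (Fa a)^[k] (a * r)

/-- `A^1_k(r) = F^k(φ(ar))` (with `A^1_0(r) = φ(ar)`). -/
noncomputable def A1 (a : ℝ) (k : ℕ) (r : ℝ) : ℝ := (Fa a)^[k] (phiFun a (a * r))

/-- `B^0(r) = F̃(ar)/(ar)`. -/
noncomputable def B0 (a : ℝ) (r : ℝ) : ℝ := Ftilde a (a * r) / (a * r)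

/-- `w^{sl}_{k,α}(t) = t · B^0(η/t) · (∏_{j=0}^{k-1} A^1_j(η/t)) · A^1_k(η/t)^α`. -/
noncomputable def wsl (a : ℝ) (k : ℕ) (α : ℝ) (η : ℝ) (t : ℝ) : ℝ :=
  t * B0 a (η / t) * (∏ j ∈ Finset.range k, A1 a j (η / t)) * (A1 a k (η / t)) ^ α


section Part0

lemma Fa_ge {a u : ℝ} (ha : 1 < a) (hu : a ≤ u) : a ≤ Fa a u := by
  have := Real.log_le_log (by linarith) hu
  simp only [Fa]; linarith

lemma Fa_iter_ge {a : ℝ} (ha : 1 < a) (k : ℕ) {u : ℝ} (hu : a ≤ u) : a ≤ (Fa a)^[k] u := by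
  induction k generalizing u with
  | zero => simpa using hu
  | succ k ih => rw [Function.iterate_succ_apply]; exact ih (Fa_ge ha hu)

lemma Fa_iter_cont {a : ℝ} (ha : 1 < a) (k : ℕ) : ContinuousOn ((Fa a)^[k]) (Ici a) := by
  induction k with
  | zero => simpa using continuousOn_id
  | succ k ih =>
    rw [Function.iterate_succ']
    have : ContinuousOn (Fa a) (Ici a) := by
      unfold Fa
      apply ContinuousOn.add continuousOn_const
      apply Real.continuousOn_log.mono
      intro x hx
      simp only [mem_Ici] at hx
      simp only [mem_compl_iff, mem_singleton_iff]; linarith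
    exact this.comp ih (fun x hx => Fa_iter_ge ha k hx)

lemma Fa_iter_le {a : ℝ} (ha : 1 < a) (k : ℕ) {u : ℝ} (hu : a ≤ u) :
    (Fa a)^[k] u - a ≤ (u - a) * (a⁻¹) ^ k := by
  induction k with
  | zero => simp
  | succ k ih =>
    rw [Function.iterate_succ_apply']
    have h1 := Fa_iter_ge ha k hu
    set v := (Fa a)^[k] u
    have h2 : Real.log (v / a) ≤ v / a - 1 := Real.log_le_sub_one_of_pos (div_pos (by linarith) (by linarith))
    rw [Real.log_div (by linarith) (by linarith)] at h2
    have h3 : Fa a v - a ≤ (v - a) * a⁻¹ := by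
      simp only [Fa]
      have : (v - a) * a⁻¹ = v / a - 1 := by field_simp
      linarith
    calc _ ≤ (v - a) * a⁻¹ := h3
      _ ≤ ((u - a) * a⁻¹ ^ k) * a⁻¹ := by gcongr
      _ = _ := by ring

lemma logterm_bound {a : ℝ} (ha : 1 < a) (k : ℕ) {u : ℝ} (hu : a ≤ u) :
    0 ≤ Real.log ((Fa a)^[k] u / a) ∧ Real.log ((Fa a)^[k] u / a) ≤ (u - a) * (a⁻¹) ^ k := by
  have h1 := Fa_iter_ge ha k hu
  have h2 := Fa_iter_le ha k hu
  have ha0 : 0 < a := by linarith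
  constructor
  · apply Real.log_nonneg
    rw [le_div_iff₀ ha0]; linarith
  · have h3 := Real.log_le_sub_one_of_pos (show 0 < (Fa a)^[k] u / a from div_pos (by linarith) ha0)
    have : (Fa a)^[k] u / a - 1 ≤ (Fa a)^[k] u - a := by
      rw [div_sub_one ha0.ne', div_le_iff₀ ha0]
      nlinarith
    linarith

lemma summ_geo {a : ℝ} (ha : 1 < a) (c : ℝ) : Summable (fun k : ℕ => c * (a⁻¹) ^ k) := by
  apply Summable.mul_left
  apply summable_geometric_of_lt_one
  · positivity
  · exact inv_lt_one_of_one_lt₀ ha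

lemma summ_log {a : ℝ} (ha : 1 < a) {u : ℝ} (hu : a ≤ u) :
    Summable (fun k : ℕ => Real.log ((Fa a)^[k] u / a)) :=
  Summable.of_nonneg_of_le (fun k => (logterm_bound ha k hu).1)
    (fun k => (logterm_bound ha k hu).2) (summ_geo ha _)

lemma Ftilde_eq {a : ℝ} (ha : 1 < a) {u : ℝ} (hu : a ≤ u) :
    Ftilde a u = a * Real.exp (∑' k : ℕ, Real.log ((Fa a)^[k] u / a)) := by
  rw [Ftilde, Real.rexp_tsum_eq_tprod _ (summ_log ha hu)]
  intro k
  have := Fa_iter_ge ha k hu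
  exact div_pos (by linarith) (by linarith)

lemma Ftilde_ge {a : ℝ} (ha : 1 < a) {u : ℝ} (hu : a ≤ u) : u ≤ Ftilde a u := by
  rw [Ftilde_eq ha hu]
  have ha0 : 0 < a := by linarith
  have h := (summ_log ha hu).le_tsum 0 (fun k _ => (logterm_bound ha k hu).1)
  simp only [Function.iterate_zero, id_eq] at h
  have h2 := Real.exp_le_exp.mpr h
  rw [Real.exp_log (div_pos (by linarith) ha0)] at h2
  rw [div_le_iff₀ ha0] at h2
  linarith

lemma Ftilde_cont {a : ℝ} (ha : 1 < a) : ContinuousOn (Ftilde a) (Ici a) := by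
  have key : ∀ M, ContinuousOn (Ftilde a) (Icc a M) := by
    intro M
    have : ContinuousOn (fun u => a * Real.exp (∑' k : ℕ, Real.log ((Fa a)^[k] u / a)))
        (Icc a M) := by
      apply continuousOn_const.mul
      apply Real.continuous_exp.comp_continuousOn
      apply continuousOn_tsum (u := fun k : ℕ => (M - a) * (a⁻¹) ^ k)
      · intro k
        apply ContinuousOn.log
        · exact ((Fa_iter_cont ha k).mono Icc_subset_Ici_self).div_const _
        · intro x hx
          have := Fa_iter_ge ha k hx.1
          exact (div_pos (by linarith) (by linarith)).ne'
      · exact summ_geo ha _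
      · intro k x hx
        rw [Real.norm_of_nonneg (logterm_bound ha k hx.1).1]
        apply (logterm_bound ha k hx.1).2.trans
        have := hx.2
        have : 0 < a := by linarith
        gcongr
    exact this.congr (fun x hx => Ftilde_eq ha hx.1)
  intro x hx
  have := key (x + 1) x ⟨hx, by linarith⟩
  apply this.mono_of_mem_nhdsWithin
  rw [← Ici_inter_Iic]
  exact inter_mem self_mem_nhdsWithin (mem_nhdsWithin_of_mem_nhds (Iic_mem_nhds (by linarith)))

lemma phi_deriv {a : ℝ} (ha : 1 < a) {u : ℝ} (hu : a < u) :
    HasDerivAt (phiFun a) (1 / Ftilde a u) u := by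
  have hc : ContinuousOn (fun t => 1 / Ftilde a t) (Ici a) := by
    apply continuousOn_const.div (Ftilde_cont ha)
    intro x hx
    have := Ftilde_ge ha hx
    simp only [mem_Ici] at hx
    linarith
  unfold phiFun
  apply HasDerivAt.const_add
  apply intervalIntegral.integral_hasDerivAt_right
  · apply ContinuousOn.intervalIntegrable
    rw [uIcc_of_le hu.le]
    exact hc.mono Icc_subset_Ici_self
  · exact ContinuousOn.stronglyMeasurableAtFilter isOpen_Ioi
      (hc.mono Ioi_subset_Ici_self) u hu
  · exact hc.continuousAt (Ici_mem_nhds hu)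

lemma phi_ge {a : ℝ} (ha : 1 < a) {u : ℝ} (hu : a ≤ u) : a ≤ phiFun a u := by
  unfold phiFun
  have : 0 ≤ ∫ t in a..u, 1 / Ftilde a t := by
    apply intervalIntegral.integral_nonneg hu
    intro x hx
    have := Ftilde_ge ha hx.1
    have : 0 < Ftilde a x := by linarith [hx.1]
    positivity
  linarith

lemma A1_ge {a : ℝ} (ha : 1 < a) (k : ℕ) {r : ℝ} (hr : 1 ≤ r) : a ≤ A1 a k r := by
  unfold A1
  exact Fa_iter_ge ha k (phi_ge ha (by nlinarith))

lemma B0_ge {a : ℝ} (ha : 1 < a) {r : ℝ} (hr : 1 ≤ r) : 1 ≤ B0 a r := by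
  unfold B0
  rw [le_div_iff₀ (by nlinarith), one_mul]
  exact Ftilde_ge ha (by nlinarith)

lemma A1_deriv {a : ℝ} (ha : 1 < a) (k : ℕ) {η : ℝ} {t : ℝ} (ht : 0 < t)
    (ht2 : t < η) :
    HasDerivAt (fun t => A1 a k (η / t))
      (-1 / (t * B0 a (η / t) * ∏ j ∈ Finset.range k, A1 a j (η / t))) t := by
  have hη : 0 < η := ht.trans ht2
  have hr : 1 < η / t := by rwa [one_lt_div ht]
  induction k with
  | zero =>
    have h1 : HasDerivAt (fun t : ℝ => a * (η / t)) (a * (-η / t ^ 2)) t := by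
      have := ((hasDerivAt_const t η).div (hasDerivAt_id t) ht.ne').const_mul a
      refine this.congr_deriv ?_
      simp
    have h2 := (phi_deriv ha (show a < a * (η / t) by nlinarith)).comp t h1
    refine h2.congr_deriv ?_
    have h3 := Ftilde_ge ha (show a ≤ a * (η / t) by nlinarith)
    have : 0 < Ftilde a (a * (η / t)) := by nlinarith
    unfold B0
    simp only [Finset.range_zero, Finset.prod_empty]
    have ha0 : 0 < a := by linarith
    field_simp
  | succ k ih =>
    have hA := A1_ge ha k hr.le
    have heq : (fun t => A1 a (k+1) (η / t)) = fun t => a - Real.log a + Real.log (A1 a k (η / t)) := by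
      funext t
      simp only [A1, Function.iterate_succ_apply', Fa]
    rw [heq]
    have := (ih.log (by linarith)).const_add (a - Real.log a)
    refine this.congr_deriv ?_
    rw [Finset.prod_range_succ, div_div]
    congr 1
    ring

lemma wsl_eq (a : ℝ) (k : ℕ) (η t : ℝ) : wsl a k 1 η t =
    t * B0 a (η / t) * ∏ j ∈ Finset.range (k+1), A1 a j (η / t) := by
  rw [wsl, Real.rpow_one, Finset.prod_range_succ]; ring

lemma wsl_ge {a : ℝ} (ha : 1 < a) (k : ℕ) {η : ℝ} {t : ℝ} (ht : 0 < t)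
    (ht2 : t ≤ η) : t ≤ wsl a k 1 η t := by
  have hr : 1 ≤ η / t := by rwa [one_le_div ht]
  rw [wsl_eq]
  have h1 := B0_ge ha hr
  have h2 : 1 ≤ ∏ j ∈ Finset.range (k+1), A1 a j (η / t) :=
    Finset.prod_induction _ (fun x => 1 ≤ x) (fun _ _ h h' => one_le_mul_of_one_le_of_one_le h h')
      le_rfl (fun i _ => by linarith [A1_ge ha i hr])
  calc t = t * 1 * 1 := by ring
    _ ≤ _ := by gcongr

lemma wsl_cont {a : ℝ} (ha : 1 < a) (k : ℕ) {η : ℝ} :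
    ContinuousOn (wsl a k 1 η) (Ioo 0 η) := by
  have : wsl a k 1 η = fun t => t * B0 a (η / t) * ∏ j ∈ Finset.range (k+1), A1 a j (η / t) := by
    funext t; exact wsl_eq a k η t
  rw [this]
  have hd : ContinuousOn (fun t : ℝ => a * (η / t)) (Ioo 0 η) :=
    continuousOn_const.mul (continuousOn_const.div continuousOn_id (fun x hx => hx.1.ne'))
  have hmap : MapsTo (fun t : ℝ => a * (η / t)) (Ioo 0 η) (Ici a) := by
    intro x hx
    have hr : 1 < η / x := by rw [one_lt_div hx.1]; exact hx.2
    simp only [mem_Ici]; nlinarith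
  apply ContinuousOn.mul
  · apply continuousOn_id.mul
    unfold B0
    apply ContinuousOn.div ((Ftilde_cont ha).comp hd hmap) hd
    intro x hx
    have := hmap hx
    simp only [mem_Ici] at this
    linarith
  · apply continuousOn_finsetProd
    intro j _ t ht
    exact (A1_deriv ha j ht.1 ht.2).continuousAt.continuousWithinAt

lemma s_deriv {a : ℝ} (ha : 1 < a) (k : ℕ) {η : ℝ} {t : ℝ} (ht : 0 < t)
    (ht2 : t < η) :
    HasDerivAt (fun t => A1 a (k+1) (η / t)) (-1 / wsl a k 1 η t) t := by
  rw [wsl_eq]; exact A1_deriv ha (k+1) ht ht2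

end Part0

section Part3

lemma young_a {p : ℝ} (hp : 1 < p) {A B : ℝ} (hA : 0 ≤ A) (hB : 0 ≤ B) :
    p * A ^ (p-1) * B ≤ (p-1)/2 * A ^ p + p * ((p-1)/(2*p)) ^ (1-p) * B ^ p := by
  have hp0 : 0 < p := by linarith
  set κ := (p-1)/(2*p) with hκ
  have hκ0 : 0 < κ := div_pos (by linarith) (by linarith)
  have hAp : A ^ (p-1) * A = A ^ p := by
    rcases hA.eq_or_lt with h | h
    · rw [← h]; simp [Real.zero_rpow hp0.ne']
    · rw [Real.rpow_sub_one h.ne']; field_simp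
  have hBp : B ^ (p-1) * B = B ^ p := by
    rcases hB.eq_or_lt with h | h
    · rw [← h]; simp [Real.zero_rpow hp0.ne']
    · rw [Real.rpow_sub_one h.ne']; field_simp
  have h0 : 0 ≤ A ^ (p-1) := by positivity
  have h00 : 0 ≤ B ^ p := by positivity
  have h000 : 0 ≤ A ^ p := by positivity
  rcases le_total B (κ * A) with h | h
  · have : p * A ^ (p-1) * B ≤ p * A ^ (p-1) * (κ * A) := by gcongr
    have e : p * A ^ (p-1) * (κ * A) = (p-1)/2 * A ^ p := by
      rw [← hAp, hκ]; field_simp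
    have : 0 ≤ p * κ ^ (1-p) * B ^ p := by positivity
    linarith
  · have hAB : A ≤ κ⁻¹ * B := by
      rw [inv_mul_eq_div, le_div_iff₀ hκ0]; linarith
    have : A ^ (p-1) ≤ (κ⁻¹ * B) ^ (p-1) := Real.rpow_le_rpow hA hAB (by linarith)
    rw [Real.mul_rpow (by positivity) hB, Real.inv_rpow hκ0.le, ← Real.rpow_neg hκ0.le, neg_sub] at this
    calc p * A ^ (p-1) * B ≤ p * (κ ^ (1-p) * B ^ (p-1)) * B := by gcongr
      _ = p * κ ^ (1-p) * B ^ p := by rw [← hBp]; ring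
      _ ≤ _ := by
        have : 0 ≤ (p-1)/2 * A ^ p := mul_nonneg (by linarith) h000
        linarith

lemma young_b {p : ℝ} (hp : 1 < p) {θ F w : ℝ} (hθ : 0 < θ) (hF : 0 ≤ F) (hw : 0 < w) :
    F ≤ θ / w + θ ^ (1-p) * (F ^ p * w ^ (p-1)) := by
  rcases le_total (F * w) θ with h | h
  · have : F ≤ θ / w := by rwa [le_div_iff₀ hw]
    have : 0 ≤ θ ^ (1-p) * (F ^ p * w ^ (p-1)) := by positivity
    linarith
  · have hF0 : 0 < F := by
      rcases hF.eq_or_lt with h' | h'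
      · rw [← h'] at h; linarith
      · exact h'
    have h1 : 1 ≤ (θ⁻¹ * (F * w)) ^ (p-1) := by
      apply Real.one_le_rpow _ (by linarith)
      rw [inv_mul_eq_div, le_div_iff₀ hθ]; linarith
    have e : θ ^ (1-p) * (F ^ p * w ^ (p-1)) = F * (θ⁻¹ * (F * w)) ^ (p-1) := by
      rw [Real.mul_rpow (by positivity) (by positivity), Real.inv_rpow hθ.le,
        ← Real.rpow_neg hθ.le, neg_sub, Real.mul_rpow hF hw.le, Real.rpow_sub_one hF0.ne']
      field_simp
    have : 0 ≤ θ / w := by positivity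
    rw [e]
    nlinarith

lemma oneD_sup {p : ℝ} (hp : 1 < p) {δ₁ δ₂ : ℝ} {w s f f' : ℝ → ℝ}
    (hw : ContinuousOn w (Icc δ₁ δ₂)) (hw0 : ∀ x ∈ Icc δ₁ δ₂, 0 < w x)
    (hs : ∀ x ∈ Icc δ₁ δ₂, HasDerivAt s (-1 / w x) x) (hs0 : ∀ x ∈ Icc δ₁ δ₂, 1 ≤ s x)
    (hf : ∀ x, HasDerivAt f (f' x) x) (hf' : Continuous f') (hf2 : f δ₂ = 0)
    {G : ℝ} (hG : 0 < G) (hGi : ∫ x in δ₁..δ₂, |f' x| ^ p * w x ^ (p-1) ≤ G)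
    {r : ℝ} (hr : r ∈ Icc δ₁ δ₂) :
    |f r| ≤ 2 * G ^ (1/p) * s r ^ ((p-1)/p) := by
  have hp0 : 0 < p := by linarith
  have hQ : ContinuousOn (fun x => |f' x| ^ p * w x ^ (p-1)) (Icc δ₁ δ₂) := by
    apply ContinuousOn.mul
    · exact (hf'.abs.rpow_const (fun x => Or.inr hp0.le)).continuousOn
    · exact hw.rpow_const (fun x hx => Or.inr (by linarith))
  have hsub : Icc r δ₂ ⊆ Icc δ₁ δ₂ := Icc_subset_Icc_left hr.1
  have hGr : ∫ x in r..δ₂, |f' x| ^ p * w x ^ (p-1) ≤ G := by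
    refine le_trans ?_ hGi
    apply intervalIntegral.integral_mono_interval hr.1 hr.2 le_rfl
    · refine (ae_restrict_iff' measurableSet_Ioc).mpr (Eventually.of_forall fun x hx => ?_)
      have := hw0 x ⟨hx.1.le, hx.2⟩
      simp only [Pi.zero_apply]
      positivity
    · exact ContinuousOn.intervalIntegrable (by rwa [uIcc_of_le (hr.1.trans hr.2)])
  have hsr : 0 < s r := by linarith [hs0 r hr]
  have hs2 := hs0 δ₂ ⟨hr.1.trans hr.2, le_rfl⟩
  -- main bound
  have main : ∀ θ > 0, |f r| ≤ θ * s r + θ ^ (1-p) * G := by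
    intro θ hθ
    have aux : ∀ ε : ℝ, |ε| = 1 → ε * f r ≤ θ * s r + θ ^ (1-p) * G := by
      intro ε hε
      have hd : ∀ x ∈ Icc r δ₂, HasDerivAt (fun x => -ε * f x + θ * s x)
          (-ε * f' x + θ * (-1 / w x)) x := fun x hx =>
        ((hf x).const_mul (-ε)).add ((hs x (hsub hx)).const_mul θ)
      have := intervalIntegral.sub_le_integral_of_hasDeriv_right_of_le (a := r) (b := δ₂)
        (g := fun x => -ε * f x + θ * s x) (g' := fun x => -ε * f' x + θ * (-1 / w x))
        (φ := fun x => θ ^ (1-p) * (|f' x| ^ p * w x ^ (p-1))) hr.2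
        (fun x hx => (hd x hx).continuousAt.continuousWithinAt)
        (fun x hx => (hd x (Ioo_subset_Icc_self hx)).hasDerivWithinAt)
        ((continuousOn_const.mul (hQ.mono hsub)).integrableOn_Icc)
        (by
          intro x hx
          have hb := young_b hp hθ (abs_nonneg (f' x)) (hw0 x (hsub (Ioo_subset_Icc_self hx)))
          have : -ε * f' x ≤ |f' x| := by
            have h1 := le_abs_self (-ε * f' x)
            rw [abs_mul, abs_neg, hε, one_mul] at h1
            exact h1
          have e : θ * (-1 / w x) = - (θ / w x) := by ring
          rw [e]
          linarith)
      rw [intervalIntegral.integral_const_mul] at this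
      simp only [hf2] at this
      have h3 : θ ^ (1-p) * ∫ x in r..δ₂, |f' x| ^ p * w x ^ (p-1) ≤ θ ^ (1-p) * G := by gcongr
      have h4 : 0 ≤ θ * s δ₂ := by positivity
      nlinarith
    rcases abs_cases (f r) with h | h
    · have := aux 1 (by simp); rw [h.1]; linarith
    · have := aux (-1) (by simp); rw [h.1]; linarith
  have hθ : 0 < (G / s r) ^ (1/p) := by positivity
  have := main _ hθ
  have e1 : (G / s r) ^ (1/p) * s r = G ^ (1/p) * s r ^ ((p-1)/p) := by
    rw [Real.div_rpow hG.le hsr.le, div_mul_eq_mul_div, mul_div_assoc]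
    congr 1
    rw [show (p-1)/p = 1 - 1/p by field_simp, Real.rpow_sub hsr, Real.rpow_one]
  have e2 : ((G / s r) ^ (1/p)) ^ (1-p) * G = G ^ (1/p) * s r ^ ((p-1)/p) := by
    rw [← Real.rpow_mul (by positivity), Real.div_rpow hG.le hsr.le,
      show (p-1)/p = -(1/p * (1-p)) by field_simp; ring, Real.rpow_neg hsr.le,
      show 1/p * (1-p) = 1/p - 1 by field_simp, Real.rpow_sub_one hG.ne']
    field_simp
  rw [e1, e2] at this
  linarith

lemma oneD_hardy {p : ℝ} (hp : 1 < p) {δ₁ δ₂ : ℝ} (hδ : δ₁ ≤ δ₂) {w s f f' : ℝ → ℝ}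
    (hw : ContinuousOn w (Icc δ₁ δ₂)) (hw0 : ∀ x ∈ Icc δ₁ δ₂, 0 < w x)
    (hs : ∀ x ∈ Icc δ₁ δ₂, HasDerivAt s (-1 / w x) x) (hs0 : ∀ x ∈ Icc δ₁ δ₂, 1 ≤ s x)
    (hf : ∀ x, HasDerivAt f (f' x) x) (hf' : Continuous f') (hf1 : f δ₁ = 0) (hf2 : f δ₂ = 0) :
    (p-1)/2 * ∫ x in δ₁..δ₂, (|f x| / s x) ^ p / w x ≤
      p * ((p-1)/(2*p)) ^ (1-p) * ∫ x in δ₁..δ₂, |f' x| ^ p * w x ^ (p-1) := by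
  have hp0 : 0 < p := by linarith
  have hQ : ContinuousOn (fun x => |f' x| ^ p * w x ^ (p-1)) (Icc δ₁ δ₂) := by
    apply ContinuousOn.mul
    · exact (hf'.abs.rpow_const (fun x => Or.inr hp0.le)).continuousOn
    · exact hw.rpow_const (fun x hx => Or.inr (by linarith))
  have hfc : Continuous f := continuous_iff_continuousAt.mpr (fun x => (hf x).continuousAt)
  have hsc : ContinuousOn s (Icc δ₁ δ₂) := fun x hx => (hs x hx).continuousAt.continuousWithinAt
  have hR : ContinuousOn (fun x => (|f x| / s x) ^ p / w x) (Icc δ₁ δ₂) := by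
    apply ContinuousOn.div _ hw (fun x hx => (hw0 x hx).ne')
    apply ContinuousOn.rpow_const _ (fun x hx => Or.inr hp0.le)
    exact hfc.abs.continuousOn.div hsc (fun x hx => by linarith [hs0 x hx])
  set c := p * ((p-1)/(2*p)) ^ (1-p) with hc
  have hd : ∀ x ∈ Icc δ₁ δ₂, HasDerivAt (fun x => |f x| ^ p * s x ^ (1-p))
      (p * |f x| ^ (p-2) * f x * f' x * s x ^ (1-p) +
        |f x| ^ p * (-1 / w x * (1-p) * s x ^ (1-p-1))) x := fun x hx =>
    ((hasDerivAt_abs_rpow (f x) hp).comp x (hf x)).mul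
      ((hs x hx).rpow_const (Or.inl (by linarith [hs0 x hx])))
  have := intervalIntegral.integral_le_sub_of_hasDeriv_right_of_le (a := δ₁) (b := δ₂)
    (φ := fun x => (p-1)/2 * ((|f x| / s x) ^ p / w x) - c * (|f' x| ^ p * w x ^ (p-1))) hδ
    (fun x hx => (hd x hx).continuousAt.continuousWithinAt)
    (fun x hx => (hd x (Ioo_subset_Icc_self hx)).hasDerivWithinAt)
    (((continuousOn_const.mul hR).sub (continuousOn_const.mul hQ)).integrableOn_Icc)
    (by
      intro x hx
      have hx := Ioo_subset_Icc_self hx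
      have hsx : 0 < s x := by linarith [hs0 x hx]
      have hwx := hw0 x hx
      have hy := young_a hp (A := |f x| / s x) (B := |f' x| * w x) (by positivity) (by positivity)
      rw [← hc] at hy
      have e1 : |f x| ^ p * (-1 / w x * (1-p) * s x ^ (1-p-1)) =
          (p-1) * ((|f x| / s x) ^ p / w x) := by
        rw [Real.div_rpow (abs_nonneg _) hsx.le, show 1 - p - 1 = -p by ring, Real.rpow_neg hsx.le]
        field_simp
        ring
      have e2 : |p * |f x| ^ (p-2) * f x * f' x * s x ^ (1-p)| =
          p * (|f x| / s x) ^ (p-1) * |f' x| := by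
        rw [abs_mul, abs_mul, abs_mul, abs_mul, abs_of_pos hp0,
          abs_of_nonneg (show 0 ≤ |f x| ^ (p-2) by positivity),
          abs_of_nonneg (show 0 ≤ s x ^ (1-p) by positivity),
          Real.div_rpow (abs_nonneg _) hsx.le, show 1 - p = -(p-1) by ring, Real.rpow_neg hsx.le]
        have : |f x| ^ (p-2) * |f x| = |f x| ^ (p-1) := by
          rcases (abs_nonneg (f x)).eq_or_lt with h | h
          · rw [← h, mul_zero, Real.zero_rpow (by linarith)]
          · rw [show p - 2 = p - 1 - 1 by ring, Real.rpow_sub_one h.ne']; field_simp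
        rw [← this]
        field_simp
      have e3 := neg_abs_le (p * |f x| ^ (p-2) * f x * f' x * s x ^ (1-p))
      rw [e2] at e3
      rw [e1]
      have e4 : p * (|f x| / s x) ^ (p-1) * |f' x| ≤
          (p-1)/2 * ((|f x| / s x) ^ p / w x) + c * (|f' x| ^ p * w x ^ (p-1)) := by
        have : p * (|f x| / s x) ^ (p-1) * |f' x| =
          (p * (|f x| / s x) ^ (p-1) * (|f' x| * w x)) / w x := by field_simp
        rw [this, div_le_iff₀ hwx]
        refine hy.trans (le_of_eq ?_)
        rw [Real.mul_rpow (abs_nonneg _) hwx.le, Real.rpow_sub_one hwx.ne']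
        field_simp
      linarith)
  rw [hf1, hf2] at this
  simp only [abs_zero, Real.zero_rpow hp0.ne', zero_mul, sub_zero] at this
  rw [intervalIntegral.integral_sub, intervalIntegral.integral_const_mul,
    intervalIntegral.integral_const_mul] at this
  · linarith
  · exact ContinuousOn.intervalIntegrable (by rw [uIcc_of_le hδ]; exact continuousOn_const.mul hR)
  · exact ContinuousOn.intervalIntegrable (by rw [uIcc_of_le hδ]; exact continuousOn_const.mul hQ)

lemma oneD {p q : ℝ} (hp : 1 < p) (hpq : p ≤ q) : ∃ C : ℝ, 0 < C ∧
    ∀ {η δ₁ δ₂ : ℝ} {w s f f' : ℝ → ℝ}, 0 < δ₁ → δ₁ ≤ δ₂ → δ₂ < η →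
    ContinuousOn w (Ioo 0 η) → (∀ x ∈ Ioo 0 η, 0 < w x) →
    (∀ x ∈ Ioo 0 η, HasDerivAt s (-1 / w x) x) → (∀ x ∈ Ioo 0 η, 1 ≤ s x) →
    (∀ x, HasDerivAt f (f' x) x) → Continuous f' → 
    (∀ x, 0 < x → x ≤ δ₁ → f x = 0) → (∀ x, δ₂ ≤ x → f x = 0) →
    ∀ {G : ℝ}, 0 < G →
    ∫⁻ x in Ioo 0 η, ENNReal.ofReal (|f' x| ^ p * w x ^ (p-1)) ≤ ENNReal.ofReal G →
    ∫⁻ x in Ioo 0 η, ENNReal.ofReal (|f x| ^ q / (w x * s x ^ (1 + q / (p / (p-1))))) ≤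
      ENNReal.ofReal (C * G ^ (q/p)) := by
  have hp0 : 0 < p := by linarith
  set c := p * ((p-1)/(2*p)) ^ (1-p) with hc
  have hc0 : 0 < c := mul_pos hp0 (Real.rpow_pos_of_pos (div_pos (by linarith) (by linarith)) _)
  refine ⟨2 ^ (q-p) * (c / ((p-1)/2)), mul_pos (by positivity) (div_pos hc0 (by linarith)), ?_⟩
  intro η δ₁ δ₂ w s f f' hδ1 hδ hδ2 hw hw0 hs hs0 hf hf' hf1 hf2 G hG hGi
  have hsub : Icc δ₁ δ₂ ⊆ Ioo 0 η := fun x hx => ⟨hδ1.trans_le hx.1, hx.2.trans_lt hδ2⟩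
  have hfc : Continuous f := continuous_iff_continuousAt.mpr (fun x => (hf x).continuousAt)
  have hsc : ContinuousOn s (Icc δ₁ δ₂) :=
    fun x hx => (hs x (hsub hx)).continuousAt.continuousWithinAt
  have hwc := hw.mono hsub
  have hQ : ContinuousOn (fun x => |f' x| ^ p * w x ^ (p-1)) (Icc δ₁ δ₂) := by
    apply ContinuousOn.mul
    · exact (hf'.abs.rpow_const (fun x => Or.inr hp0.le)).continuousOn
    · exact hwc.rpow_const (fun x hx => Or.inr (by linarith))
  have hR : ContinuousOn (fun x => (|f x| / s x) ^ p / w x) (Icc δ₁ δ₂) := by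
    apply ContinuousOn.div _ hwc (fun x hx => (hw0 x (hsub hx)).ne')
    apply ContinuousOn.rpow_const _ (fun x hx => Or.inr hp0.le)
    exact hfc.abs.continuousOn.div hsc (fun x hx => by linarith [hs0 x (hsub hx)])
  have hT : ContinuousOn (fun x => |f x| ^ q / (w x * s x ^ (1 + q / (p / (p-1)))))
      (Icc δ₁ δ₂) := by
    apply ContinuousOn.div
    · exact (hfc.abs.rpow_const (fun x => Or.inr (by linarith))).continuousOn
    · exact hwc.mul (hsc.rpow_const (fun x hx => Or.inl (by linarith [hs0 x (hsub hx)])))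
    · intro x hx
      have := hw0 x (hsub hx)
      have : 0 < s x := by linarith [hs0 x (hsub hx)]
      positivity
  have hGr : ∫ x in δ₁..δ₂, |f' x| ^ p * w x ^ (p-1) ≤ G := by
    rw [intervalIntegral.integral_of_le hδ, ← ENNReal.ofReal_le_ofReal_iff hG.le,
      ofReal_integral_eq_lintegral_ofReal]
    · refine le_trans (lintegral_mono_set ?_) hGi
      exact Ioc_subset_Icc_self.trans hsub
    · exact hQ.integrableOn_Icc.mono_set Ioc_subset_Icc_self
    · refine (ae_restrict_iff' measurableSet_Ioc).mpr (Eventually.of_forall fun x hx => ?_)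
      have := hw0 x (hsub ⟨hx.1.le, hx.2⟩)
      simp only [Pi.zero_apply]
      positivity
  have hH := oneD_hardy hp hδ hwc (fun x hx => hw0 x (hsub hx)) (fun x hx => hs x (hsub hx))
    (fun x hx => hs0 x (hsub hx)) hf hf' (hf1 _ hδ1 le_rfl) (hf2 _ le_rfl)
  rw [← hc] at hH
  have hfin : ∫ x in δ₁..δ₂, |f x| ^ q / (w x * s x ^ (1 + q / (p / (p-1)))) ≤
      2 ^ (q-p) * (c / ((p-1)/2)) * G ^ (q/p) := by
    calc _ ≤ ∫ x in δ₁..δ₂, (2 * G ^ (1/p)) ^ (q-p) * ((|f x| / s x) ^ p / w x) := by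
          apply intervalIntegral.integral_mono_on hδ
          · exact ContinuousOn.intervalIntegrable (by rwa [uIcc_of_le hδ])
          · exact ContinuousOn.intervalIntegrable
              (by rw [uIcc_of_le hδ]; exact continuousOn_const.mul hR)
          · intro x hx
            have hwx := hw0 x (hsub hx)
            have hsx : 0 < s x := by linarith [hs0 x (hsub hx)]
            have hb := oneD_sup hp hwc (fun x hx => hw0 x (hsub hx)) (fun x hx => hs x (hsub hx))
              (fun x hx => hs0 x (hsub hx)) hf hf' (hf2 _ le_rfl) hG hGr hx
            have hb2 := Real.rpow_le_rpow (abs_nonneg _) hb (sub_nonneg.mpr hpq)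
            rw [Real.mul_rpow (by positivity) (by positivity), ← Real.rpow_mul hsx.le] at hb2
            have e0 : |f x| ^ q = |f x| ^ p * |f x| ^ (q-p) := by
              rcases hpq.eq_or_lt with h | h
              · subst h; simp
              · rw [← Real.rpow_add_of_nonneg (abs_nonneg _) hp0.le (by linarith)]
                congr 1; ring
            rw [e0, Real.div_rpow (abs_nonneg _) hsx.le,
              show 1 + q / (p / (p-1)) = p + (p-1)/p * (q-p) by field_simp; ring,
              Real.rpow_add hsx]
            rw [div_le_iff₀ (by positivity)]
            calc |f x| ^ p * |f x| ^ (q-p) ≤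
                |f x| ^ p * ((2 * G ^ (1/p)) ^ (q-p) * s x ^ ((p-1)/p * (q-p))) := by gcongr
              _ = _ := by field_simp
      _ = (2 * G ^ (1/p)) ^ (q-p) * ∫ x in δ₁..δ₂, (|f x| / s x) ^ p / w x :=
          intervalIntegral.integral_const_mul _ _
      _ ≤ (2 * G ^ (1/p)) ^ (q-p) * (c / ((p-1)/2) * G) := by
          gcongr
          rw [div_mul_eq_mul_div, le_div_iff₀ (by linarith)]
          calc _ = (p-1)/2 * ∫ x in δ₁..δ₂, (|f x| / s x) ^ p / w x := by ring
            _ ≤ _ := hH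
            _ ≤ _ := by gcongr
      _ = _ := by
          rw [Real.mul_rpow (by positivity) (by positivity), ← Real.rpow_mul hG.le,
            show q/p = 1/p * (q-p) + 1 by field_simp; ring, Real.rpow_add_one hG.ne']
          ring
  set T := fun x => |f x| ^ q / (w x * s x ^ (1 + q / (p / (p-1))))
  calc ∫⁻ x in Ioo 0 η, ENNReal.ofReal (T x)
      = ∫⁻ x in Ioo 0 η, (Ioc δ₁ δ₂).indicator (fun x => ENNReal.ofReal (T x)) x := by
        apply setLIntegral_congr_fun measurableSet_Ioo
        intro x hx
        by_cases h : x ∈ Ioc δ₁ δ₂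
        · simp [h]
        · simp only [h, not_false_eq_true, indicator_of_notMem]
          have : f x = 0 := by
            simp only [mem_Ioc, not_and_or, not_lt, not_le] at h
            rcases h with h | h
            · exact hf1 x hx.1 h
            · exact hf2 x h.le
          simp [T, this, Real.zero_rpow (show q ≠ 0 by linarith)]
    _ ≤ ∫⁻ x, (Ioc δ₁ δ₂).indicator (fun x => ENNReal.ofReal (T x)) x := 
        setLIntegral_le_lintegral _ _
    _ = ∫⁻ x in Ioc δ₁ δ₂, ENNReal.ofReal (T x) := lintegral_indicator measurableSet_Ioc _
    _ = ENNReal.ofReal (∫ x in Ioc δ₁ δ₂, T x) := by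
        rw [ofReal_integral_eq_lintegral_ofReal]
        · exact hT.integrableOn_Icc.mono_set Ioc_subset_Icc_self
        · refine (ae_restrict_iff' measurableSet_Ioc).mpr (Eventually.of_forall fun x hx => ?_)
          have := hw0 x (hsub ⟨hx.1.le, hx.2⟩)
          have : 0 < s x := by linarith [hs0 x (hsub ⟨hx.1.le, hx.2⟩)]
          simp only [Pi.zero_apply, T]
          positivity
    _ ≤ _ := by
        rw [← intervalIntegral.integral_of_le hδ]
        exact ENNReal.ofReal_le_ofReal hfin

end Part3

section Part1

open scoped ENNReal NNReal

lemma jensen_unit {p : ℝ} (hp : 1 ≤ p) {h : ℝ → ℝ≥0∞} (hh : Measurable h) :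
    (∫⁻ s in Icc (0:ℝ) 1, h s) ^ p ≤ ∫⁻ s in Icc (0:ℝ) 1, h s ^ p := by
  have hp0 : 0 < p := by linarith
  have : IsProbabilityMeasure (volume.restrict (Icc (0:ℝ) 1)) := ⟨by simp⟩
  have := eLpNorm'_le_eLpNorm'_of_exponent_le (f := h) (μ := volume.restrict (Icc (0:ℝ) 1))
    (p := 1) (q := p) one_pos hp hh.aestronglyMeasurable
  simp only [eLpNorm', enorm_eq_self, ENNReal.rpow_one, ne_eq, one_ne_zero, not_false_eq_true,
    div_self] at this
  calc _ ≤ ((∫⁻ s in Icc (0:ℝ) 1, h s ^ p) ^ (1/p)) ^ p := ENNReal.rpow_le_rpow this hp0.le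
    _ = _ := by rw [← ENNReal.rpow_mul, one_div, inv_mul_cancel₀ hp0.ne', ENNReal.rpow_one]

variable {n : ℕ}


lemma line_bound {p : ℝ} (hp : 1 ≤ p) {u : EuclideanSpace ℝ (Fin n) → ℝ} (hu : ContDiff ℝ 1 u)
    (x y : EuclideanSpace ℝ (Fin n)) :
    ‖u x - u y‖ₑ ^ p ≤ ‖y - x‖ₑ ^ p *
      ∫⁻ s in Icc (0:ℝ) 1, ‖fderiv ℝ u ((1-s) • x + s • y)‖ₑ ^ p := by
  have hp0 : 0 < p := by linarith
  set g : ℝ → ℝ := fun s => u ((1-s) • x + s • y) with hg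
  have hgc : ContDiff ℝ 1 g := by
    apply hu.comp
    fun_prop
  have hgd : ∀ s, HasDerivAt g (fderiv ℝ u ((1-s) • x + s • y) (y - x)) s := by
    intro s
    have h1 : HasDerivAt (fun s : ℝ => (1-s) • x + s • y) (y - x) s := by
      have := (((hasDerivAt_id s).const_sub 1).smul_const x).add ((hasDerivAt_id s).smul_const y)
      refine this.congr_deriv ?_
      simp [sub_eq_neg_add]
    exact ((hu.differentiable one_ne_zero) _).hasFDerivAt.comp_hasDerivAt s h1
  have h1 := enorm_sub_le_lintegral_deriv_of_contDiffOn_Icc (f := g) (a := 0) (b := 1)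
    hgc.contDiffOn zero_le_one
  have hc : Continuous (fun s : ℝ => ‖fderiv ℝ u ((1-s) • x + s • y)‖ₑ) := by
    apply continuous_enorm.comp
    apply (hu.continuous_fderiv one_ne_zero).comp
    fun_prop
  have h2 : ‖u x - u y‖ₑ ≤ ∫⁻ s in Icc (0:ℝ) 1, ‖y - x‖ₑ * ‖fderiv ℝ u ((1-s) • x + s • y)‖ₑ := by
    have e : u x - u y = -(g 1 - g 0) := by simp [hg]
    rw [e, enorm_neg]
    refine h1.trans (lintegral_mono fun s => ?_)
    rw [(hgd s).deriv, mul_comm]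
    exact ContinuousLinearMap.le_opENorm _ _
  rw [lintegral_const_mul _ hc.measurable] at h2
  calc _ ≤ (‖y - x‖ₑ * ∫⁻ s in Icc (0:ℝ) 1, ‖fderiv ℝ u ((1-s) • x + s • y)‖ₑ) ^ p :=
        ENNReal.rpow_le_rpow h2 hp0.le
    _ = ‖y - x‖ₑ ^ p * (∫⁻ s in Icc (0:ℝ) 1, ‖fderiv ℝ u ((1-s) • x + s • y)‖ₑ) ^ p :=
        ENNReal.mul_rpow_of_nonneg _ _ hp0.le
    _ ≤ _ := by
      gcongr
      exact jensen_unit hp hc.measurable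

lemma lintegral_comp_affine (h : (EuclideanSpace ℝ (Fin n)) → ℝ≥0∞) (hh : Measurable h) (v : (EuclideanSpace ℝ (Fin n))) {s : ℝ} (hs : 0 < s) :
    ∫⁻ y, h (v + s • y) = ENNReal.ofReal ((s ^ n)⁻¹) * ∫⁻ y, h y := by
  have h1 := Measure.map_addHaar_smul (volume : Measure (EuclideanSpace ℝ (Fin n))) hs.ne'
  have h2 : ∫⁻ z, h (v + z) ∂(Measure.map (s • ·) (volume : Measure (EuclideanSpace ℝ (Fin n)))) = ∫⁻ y, h (v + s • y) := by
    rw [lintegral_map (f := fun z => h (v + z)) (hh.comp (measurable_const_add v)) (measurable_const_smul s)]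
  rw [← h2, h1, lintegral_smul_measure, lintegral_add_left_eq_self]
  simp only [finrank_euclideanSpace, Fintype.card_fin, smul_eq_mul]
  rw [abs_of_pos (by positivity)]

lemma J_half (h : (EuclideanSpace ℝ (Fin n)) → ℝ≥0∞) (hh : Measurable h) (x₀ : (EuclideanSpace ℝ (Fin n))) (R : ℝ) {s : ℝ} (hs : 1/2 ≤ s)
    (hs1 : s ≤ 1) {x : (EuclideanSpace ℝ (Fin n))} (hx : x ∈ Metric.ball x₀ R) :
    ∫⁻ y in Metric.ball x₀ R, h ((1-s) • x + s • y) ≤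
      2 ^ n * ∫⁻ z in Metric.ball x₀ R, h z := by
  set B := Metric.ball x₀ R
  have hB : MeasurableSet B := measurableSet_ball
  calc ∫⁻ y in B, h ((1-s) • x + s • y) ≤ ∫⁻ y, B.indicator h ((1-s) • x + s • y) := by
        rw [← lintegral_indicator hB]
        apply lintegral_mono
        intro y
        by_cases hy : y ∈ B
        · have : (1-s) • x + s • y ∈ B :=
            (convex_ball x₀ R) hx hy (by linarith) (by linarith) (by ring)
          simp [hy, this]
        · simp [hy]
    _ = ENNReal.ofReal ((s ^ n)⁻¹) * ∫⁻ y, B.indicator h y :=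
        lintegral_comp_affine _ (hh.indicator hB) _ (by linarith)
    _ ≤ _ := by
        rw [lintegral_indicator hB]
        gcongr
        rw [show (2:ℝ≥0∞) ^ n = ENNReal.ofReal (2 ^ n) by
          rw [ENNReal.ofReal_pow (by norm_num)]; simp]
        apply ENNReal.ofReal_le_ofReal
        rw [← inv_pow]
        gcongr
        rw [inv_le_comm₀ (by linarith) (by norm_num)]
        linarith

lemma J_bound (h : (EuclideanSpace ℝ (Fin n)) → ℝ≥0∞) (hh : Measurable h) (x₀ : (EuclideanSpace ℝ (Fin n))) (R : ℝ) {s : ℝ} (hs : s ∈ Icc (0:ℝ) 1) :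
    ∫⁻ x in Metric.ball x₀ R, ∫⁻ y in Metric.ball x₀ R, h ((1-s) • x + s • y) ≤
      2 ^ n * (∫⁻ z in Metric.ball x₀ R, h z) * volume (Metric.ball x₀ R) := by
  have main : ∀ s ∈ Icc (1/2:ℝ) 1, 
    ∫⁻ x in Metric.ball x₀ R, ∫⁻ y in Metric.ball x₀ R, h ((1-s) • x + s • y) ≤
      2 ^ n * (∫⁻ z in Metric.ball x₀ R, h z) * volume (Metric.ball x₀ R) := by
    intro s hs
    calc _ ≤ ∫⁻ x in Metric.ball x₀ R, 2 ^ n * (∫⁻ z in Metric.ball x₀ R, h z) := by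
          apply setLIntegral_mono' measurableSet_ball
          intro x hx
          exact J_half h hh x₀ R hs.1 hs.2 hx
      _ = _ := by rw [setLIntegral_const]
  rcases le_total (1/2) s with h1 | h1
  · exact main s ⟨h1, hs.2⟩
  · have := main (1-s) ⟨by linarith, by linarith [hs.1]⟩
    rw [lintegral_lintegral_swap]
    · refine le_trans (le_of_eq ?_) this
      congr! 4 with x y
      rw [add_comm]; simp
    · apply Measurable.aemeasurable
      apply hh.comp
      fun_prop

lemma poincare_ball {p : ℝ} (hp : 1 ≤ p) (x₀ : (EuclideanSpace ℝ (Fin n))) {R : ℝ} (hR : 0 < R) :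
    ∃ C : ℝ≥0, ∀ u : (EuclideanSpace ℝ (Fin n)) → ℝ, ContDiff ℝ 1 u → ∃ c : ℝ,
      ∫⁻ x in Metric.ball x₀ R, ‖u x - c‖ₑ ^ p ≤
        C * ∫⁻ x in Metric.ball x₀ R, ‖fderiv ℝ u x‖ₑ ^ p := by
  set B := Metric.ball x₀ R
  have hp0 : 0 < p := by linarith
  have hB0 : volume B ≠ 0 := (Metric.measure_ball_pos volume x₀ hR).ne'
  have hBt : volume B ≠ ∞ := measure_ball_lt_top.ne
  refine ⟨(ENNReal.ofReal (2*R) ^ p * 2 ^ n).toNNReal, fun u hu => ?_⟩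
  rw [ENNReal.coe_toNNReal (by finiteness)]
  set h : (EuclideanSpace ℝ (Fin n)) → ℝ≥0∞ := fun z => ‖fderiv ℝ u z‖ₑ ^ p with hh
  have hhc : Measurable h := 
    (ENNReal.continuous_rpow_const.comp (continuous_enorm.comp (hu.continuous_fderiv one_ne_zero))).measurable
  have huc := hu.continuous
  have hdouble : ∫⁻ y in B, ∫⁻ x in B, ‖u x - u y‖ₑ ^ p ≤
      (ENNReal.ofReal (2*R) ^ p * 2 ^ n * ∫⁻ x in B, h x) * volume B := by
    calc ∫⁻ y in B, ∫⁻ x in B, ‖u x - u y‖ₑ ^ p 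
        ≤ ∫⁻ y in B, ∫⁻ x in B, ENNReal.ofReal (2*R) ^ p *
          ∫⁻ s in Icc (0:ℝ) 1, h ((1-s) • x + s • y) := by
          apply setLIntegral_mono' measurableSet_ball
          intro y hy
          apply setLIntegral_mono' measurableSet_ball
          intro x hx
          refine (line_bound hp hu x y).trans ?_
          gcongr
          rw [← ofReal_norm]
          apply ENNReal.ofReal_le_ofReal
          rw [← dist_eq_norm]
          have h1 : dist y x₀ < R := hy
          have h2 : dist x x₀ < R := hx
          linarith [dist_triangle_right y x x₀]
      _ = ENNReal.ofReal (2*R) ^ p * ∫⁻ s in Icc (0:ℝ) 1, ∫⁻ y in B, ∫⁻ x in B,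
            h ((1-s) • x + s • y) := by
          have m3 : Measurable (fun z : ((EuclideanSpace ℝ (Fin n)) × (EuclideanSpace ℝ (Fin n))) × ℝ => h ((1-z.2) • z.1.1 + z.2 • z.1.2)) := by
            apply hhc.comp; fun_prop
          have m3' : Measurable (fun z : ((EuclideanSpace ℝ (Fin n)) × ℝ) × (EuclideanSpace ℝ (Fin n)) => h ((1-z.1.2) • z.2 + z.1.2 • z.1.1)) := by
            apply hhc.comp; fun_prop
          have e1 : ∀ y : (EuclideanSpace ℝ (Fin n)), ∫⁻ x in B, ENNReal.ofReal (2*R) ^ p *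
              ∫⁻ s in Icc (0:ℝ) 1, h ((1-s) • x + s • y) = ENNReal.ofReal (2*R) ^ p *
              ∫⁻ s in Icc (0:ℝ) 1, ∫⁻ x in B, h ((1-s) • x + s • y) := by
            intro y
            rw [lintegral_const_mul' _ _ (by finiteness), lintegral_lintegral_swap]
            apply Measurable.aemeasurable
            apply hhc.comp
            fun_prop
          simp_rw [e1]
          rw [lintegral_const_mul' _ _ (by finiteness), lintegral_lintegral_swap]
          apply Measurable.aemeasurable
          exact m3'.lintegral_prod_right'
      _ ≤ ENNReal.ofReal (2*R) ^ p * ∫⁻ s in Icc (0:ℝ) 1, 2 ^ n * (∫⁻ z in B, h z) * volume B := by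
          refine mul_le_mul_right ?_ _
          apply setLIntegral_mono' measurableSet_Icc
          intro s hs
          rw [lintegral_lintegral_swap]
          · exact J_bound h hhc x₀ R hs
          · apply Measurable.aemeasurable
            apply hhc.comp
            fun_prop
      _ = _ := by
          rw [setLIntegral_const]; simp; ring
  have hm : Measurable (fun y => ∫⁻ x in B, ‖u x - u y‖ₑ ^ p) := by
    apply Measurable.lintegral_prod_right' (f := fun z : (EuclideanSpace ℝ (Fin n)) × (EuclideanSpace ℝ (Fin n)) => ‖u z.2 - u z.1‖ₑ ^ p)
    have : Continuous (fun z : (EuclideanSpace ℝ (Fin n)) × (EuclideanSpace ℝ (Fin n)) => ‖u z.2 - u z.1‖ₑ ^ p) := by fun_prop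
    exact this.measurable
  have : IsFiniteMeasure (volume.restrict B) := ⟨by simpa using hBt.lt_top⟩
  obtain ⟨y, -, hy⟩ := exists_notMem_null_le_laverage (μ := volume.restrict B)
    (by simpa using hB0) hm.aemeasurable (measure_empty)
  refine ⟨u y, hy.trans ?_⟩
  rw [laverage_eq, Measure.restrict_apply_univ]
  exact ENNReal.div_le_of_le_mul hdouble

end Part1

section Part1b

open scoped ENNReal NNReal

variable {n : ℕ}

lemma choose_p0 {p q : ℝ} (hn : 2 ≤ n) (hp : 1 < p) (hpq : p ≤ q)
    (h2 : 1 / p - 1 / q ≤ 1 / (n : ℝ)) :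
    ∃ p₀ : ℝ, 1 ≤ p₀ ∧ p₀ < n ∧ p₀ ≤ p ∧ p₀⁻¹ - (n:ℝ)⁻¹ ≤ q⁻¹ := by
  have hn2 : (2:ℝ) ≤ n := by exact_mod_cast hn
  have hn0 : (0:ℝ) < n := by linarith
  have hq0 : 0 < q := by linarith
  rcases lt_or_ge p n with h | h
  · refine ⟨p, hp.le, h, le_rfl, ?_⟩
    simp only [one_div] at h2
    linarith
  · have hqn : (n:ℝ) ≤ q := h.trans hpq
    have hpos : 0 < q⁻¹ + (n:ℝ)⁻¹ := by positivity
    have hlt : (q⁻¹ + (n:ℝ)⁻¹)⁻¹ < n := by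
      rw [inv_lt_comm₀ hpos hn0]
      have : 0 < q⁻¹ := by positivity
      linarith
    refine ⟨(q⁻¹ + (n:ℝ)⁻¹)⁻¹, ?_, hlt, hlt.le.trans h, ?_⟩
    · rw [one_le_inv₀ hpos]
      have h3 : q⁻¹ ≤ 2⁻¹ := inv_anti₀ (by norm_num) (by linarith)
      have h4 : (n:ℝ)⁻¹ ≤ 2⁻¹ := inv_anti₀ (by norm_num) (by linarith)
      linarith
    · rw [inv_inv]; linarith

lemma sob_ball {p q : ℝ} (hn : 2 ≤ n) (hp : 1 < p) (hpq : p ≤ q)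
    (h2 : 1 / p - 1 / q ≤ 1 / (n : ℝ)) (x₀ : (EuclideanSpace ℝ (Fin n))) {R : ℝ} (hR : 0 < R) :
    ∃ C : ℝ≥0, ∀ u : (EuclideanSpace ℝ (Fin n)) → ℝ, ContDiff ℝ 1 u → ∃ c : ℝ,
      ∫⁻ x in Metric.ball x₀ R, ‖u x - c‖ₑ ^ q ≤
        C * (∫⁻ x in Metric.ball x₀ (2*R), ‖fderiv ℝ u x‖ₑ ^ p) ^ (q/p) := by
  have hp0 : 0 < p := by linarith
  have hq0 : 0 < q := by linarith
  obtain ⟨p₀, h1p, hpn, hpp, hpq'⟩ := choose_p0 hn hp hpq h2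
  obtain ⟨CP, hCP⟩ := poincare_ball (n := n) hp.le x₀ (show 0 < 2 * R by linarith)
  set B2 := Metric.ball x₀ (2*R) with hB2
  let χ : ContDiffBump x₀ := ⟨R, 3/2*R, hR, by linarith⟩
  have hχc : ContDiff ℝ 1 χ := χ.contDiff
  obtain ⟨M, hM⟩ : ∃ M : ℝ, ∀ x, ‖fderiv ℝ χ x‖ ≤ M :=
    (χ.hasCompactSupport.fderiv (𝕜 := ℝ)).exists_bound_of_continuous
      (hχc.continuous_fderiv one_ne_zero)
  have hM0 : 0 ≤ M := (norm_nonneg _).trans (hM x₀)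
  set K := eLpNormLESNormFDerivOfLeConst ℝ (volume : Measure (EuclideanSpace ℝ (Fin n))) B2
    p₀.toNNReal q.toNNReal with hK
  set V := volume B2 with hV
  have hVt : V ≠ ∞ := measure_ball_lt_top.ne
  set C2 : ℝ≥0∞ := 2 ^ (p-1) * (1 + ENNReal.ofReal M ^ p * CP) with hC2
  have hC2t : C2 ≠ ∞ := by rw [hC2]; finiteness
  have hexp : 0 ≤ 1/p₀ - 1/p := by
    rw [sub_nonneg]
    exact one_div_le_one_div_of_le (by linarith) hpp
  set CT : ℝ≥0∞ := (K * (C2 ^ (1/p) * V ^ (1/p₀ - 1/p))) ^ q with hCT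
  have hCTt : CT ≠ ∞ := by rw [hCT]; finiteness
  refine ⟨CT.toNNReal, fun u hu => ?_⟩
  rw [ENNReal.coe_toNNReal hCTt]
  obtain ⟨c, hc⟩ := hCP u hu
  refine ⟨c, ?_⟩
  set X := ∫⁻ x in B2, ‖fderiv ℝ u x‖ₑ ^ p with hX
  set v : (EuclideanSpace ℝ (Fin n)) → ℝ := fun x => χ x * (u x - c) with hv
  have hvc : ContDiff ℝ 1 v := hχc.mul (hu.sub contDiff_const)
  have hts : tsupport v ⊆ B2 := by
    have h1 : tsupport v ⊆ tsupport χ := tsupport_mul_subset_left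
    rw [χ.tsupport_eq] at h1
    refine h1.trans ?_
    apply Metric.closedBall_subset_ball
    change 3/2*R < 2*R
    linarith
  have hgns := eLpNorm_le_eLpNorm_fderiv_of_le (volume : Measure (EuclideanSpace ℝ (Fin n)))
    (u := v) (s := B2) hvc ((subset_tsupport v).trans hts) (p := p₀.toNNReal) (q := q.toNNReal)
    (by rwa [Real.one_le_toNNReal])
    (by
      rw [finrank_euclideanSpace, Fintype.card_fin]
      rw [← NNReal.coe_lt_coe, Real.coe_toNNReal _ (by linarith)]
      simpa using hpn)
    (by
      rw [NNReal.coe_inv, Real.coe_toNNReal _ (by linarith),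
        Real.coe_toNNReal _ (by linarith), finrank_euclideanSpace, Fintype.card_fin]
      exact hpq')
    Metric.isBounded_ball
  rw [← hK] at hgns
  have hdv : Function.support (fderiv ℝ v) ⊆ B2 := (support_fderiv_subset ℝ).trans hts
  -- pass from p₀ to p on B2
  have hstep : eLpNorm (fderiv ℝ v) p₀.toNNReal volume ≤
      (∫⁻ x in B2, ‖fderiv ℝ v x‖ₑ ^ p) ^ (1/p) * V ^ (1/p₀ - 1/p) := by
    have hres : eLpNorm (fderiv ℝ v) p₀.toNNReal volume =
        eLpNorm (fderiv ℝ v) p₀.toNNReal (volume.restrict B2) := by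
      rw [← eLpNorm_norm, ← eLpNorm_norm (μ := volume.restrict B2)]
      refine (eLpNorm_restrict_eq_of_support_subset ?_).symm
      intro x hx
      apply hdv
      intro h0
      apply hx
      simp [h0]
    rw [hres]
    have h3 := eLpNorm_le_eLpNorm_mul_rpow_measure_univ (f := fderiv ℝ v)
      (μ := volume.restrict B2) (p := p₀.toNNReal) (q := p.toNNReal)
      (by exact_mod_cast Real.toNNReal_le_toNNReal hpp)
      (hvc.continuous_fderiv one_ne_zero).aestronglyMeasurable
    rw [Measure.restrict_apply_univ, ← hV] at h3
    simp only [ENNReal.coe_toReal] at h3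
    rw [Real.coe_toNNReal _ (by linarith), Real.coe_toNNReal _ (by linarith)] at h3
    refine h3.trans (le_of_eq ?_)
    congr 1
    rw [eLpNorm_eq_lintegral_rpow_enorm_toReal (by simpa using hp0) (by simp)]
    simp only [ENNReal.coe_toReal]
    rw [Real.coe_toNNReal _ (by linarith)]
  have hbound : ∫⁻ x in B2, ‖fderiv ℝ v x‖ₑ ^ p ≤ C2 * X := by
    have hpt : ∀ x, ‖fderiv ℝ v x‖ₑ ^ p ≤
        2 ^ (p-1) * (‖fderiv ℝ u x‖ₑ ^ p + ENNReal.ofReal M ^ p * ‖u x - c‖ₑ ^ p) := by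
      intro x
      have hd : HasFDerivAt v (χ x • fderiv ℝ u x + (u x - c) • fderiv ℝ χ x) x := by
        have h1 := ((hχc.differentiable one_ne_zero) x).hasFDerivAt
        have h2 := (((hu.differentiable one_ne_zero) x).hasFDerivAt).sub_const c
        exact h1.mul h2
      rw [hd.fderiv]
      have h5 : ‖χ x • fderiv ℝ u x + (u x - c) • fderiv ℝ χ x‖ₑ ≤
          ‖fderiv ℝ u x‖ₑ + ENNReal.ofReal M * ‖u x - c‖ₑ := by
        rw [← ofReal_norm, ← ofReal_norm, ← ofReal_norm, ← ENNReal.ofReal_mul hM0,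
          ← ENNReal.ofReal_add (by positivity) (by positivity)]
        apply ENNReal.ofReal_le_ofReal
        refine (norm_add_le _ _).trans ?_
        rw [norm_smul, norm_smul]
        have h6 : ‖χ x‖ ≤ 1 := by
          rw [Real.norm_of_nonneg χ.nonneg]; exact χ.le_one
        have h7 := hM x
        have h8 := norm_nonneg (fderiv ℝ u x)
        have h9 := norm_nonneg (u x - c)
        nlinarith
      calc _ ≤ (‖fderiv ℝ u x‖ₑ + ENNReal.ofReal M * ‖u x - c‖ₑ) ^ p :=
            ENNReal.rpow_le_rpow h5 hp0.le
        _ ≤ _ := by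
            rw [← ENNReal.mul_rpow_of_nonneg _ _ hp0.le]
            exact ENNReal.rpow_add_le_mul_rpow_add_rpow _ _ hp.le
    have hmu : Measurable (fun x => ‖fderiv ℝ u x‖ₑ ^ p) :=
      (ENNReal.continuous_rpow_const.comp (continuous_enorm.comp
        (hu.continuous_fderiv one_ne_zero))).measurable
    calc _ ≤ ∫⁻ x in B2, 2 ^ (p-1) * (‖fderiv ℝ u x‖ₑ ^ p + ENNReal.ofReal M ^ p * ‖u x - c‖ₑ ^ p) :=
          lintegral_mono hpt
      _ = 2 ^ (p-1) * (X + ENNReal.ofReal M ^ p * ∫⁻ x in B2, ‖u x - c‖ₑ ^ p) := by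
          rw [lintegral_const_mul' _ _ (by finiteness), lintegral_add_left hmu,
            lintegral_const_mul' _ _ (by finiteness)]
      _ ≤ 2 ^ (p-1) * (X + ENNReal.ofReal M ^ p * (CP * X)) := by gcongr
      _ = C2 * X := by rw [hC2]; ring
  calc ∫⁻ x in Metric.ball x₀ R, ‖u x - c‖ₑ ^ q = ∫⁻ x in Metric.ball x₀ R, ‖v x‖ₑ ^ q := by
        apply setLIntegral_congr_fun measurableSet_ball
        intro x hx
        have : χ x = 1 := χ.one_of_mem_closedBall (Metric.ball_subset_closedBall hx)
        simp [hv, this]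
    _ ≤ ∫⁻ x, ‖v x‖ₑ ^ q := setLIntegral_le_lintegral _ _
    _ = (eLpNorm v q.toNNReal volume) ^ q := by
        rw [eLpNorm_eq_lintegral_rpow_enorm_toReal (by simpa using hq0) (by simp)]
        simp only [ENNReal.coe_toReal]
        rw [Real.coe_toNNReal _ hq0.le, ← ENNReal.rpow_mul, one_div, inv_mul_cancel₀ hq0.ne',
          ENNReal.rpow_one]
    _ ≤ (K * ((C2 * X) ^ (1/p) * V ^ (1/p₀ - 1/p))) ^ q := by
        apply ENNReal.rpow_le_rpow _ hq0.le
        refine hgns.trans ?_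
        gcongr
        refine hstep.trans ?_
        gcongr
    _ = ((K * (C2 ^ (1/p) * V ^ (1/p₀ - 1/p))) * X ^ (1/p)) ^ q := by
        rw [ENNReal.mul_rpow_of_nonneg C2 X (show 0 ≤ 1/p by positivity)]
        congr 1; ring
    _ = CT * X ^ (q/p) := by
        rw [ENNReal.mul_rpow_of_nonneg _ _ hq0.le, ← ENNReal.rpow_mul, hCT]
        congr 2; ring

end Part1b

section Part2a

open scoped ENNReal NNReal

lemma enorm_tri {q : ℝ} (hq : 1 ≤ q) (a b c : ℝ) :
    ‖a - b‖ₑ ^ q ≤ 2 ^ (q-1) * (‖a - c‖ₑ ^ q + ‖b - c‖ₑ ^ q) := by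
  refine le_trans ?_ (ENNReal.rpow_add_le_mul_rpow_add_rpow _ _ hq)
  apply ENNReal.rpow_le_rpow _ (by linarith)
  have : a - b = (a - c) - (b - c) := by ring
  rw [this]
  exact enorm_sub_le

lemma overlap_bound {X : Type*} [MeasurableSpace X] (μ : Measure X) {q : ℝ} (hq : 1 ≤ q)
    {ι : Type*} (f : ι → X → ℝ) (hf : ∀ i, Measurable (f i)) (N : ι → ℝ≥0∞)
    (c c' : ι → ℝ) {S S' : Set X}
    (hpos : μ (S ∩ S') ≠ 0) (hfin : μ S' ≠ ∞)
    (h1 : ∃ C : ℝ≥0, ∀ i, ∫⁻ x in S, ‖f i x - c i‖ₑ ^ q ∂μ ≤ C * N i)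
    (h2 : ∃ C : ℝ≥0, ∀ i, ∫⁻ x in S', ‖f i x - c' i‖ₑ ^ q ∂μ ≤ C * N i) :
    ∃ C : ℝ≥0, ∀ i, ∫⁻ x in S', ‖f i x - c i‖ₑ ^ q ∂μ ≤ C * N i := by
  obtain ⟨C1, h1⟩ := h1
  obtain ⟨C2, h2⟩ := h2
  have hq0 : 0 ≤ q := by linarith
  set m := μ (S ∩ S') with hm
  have hmt : m ≠ ∞ := ne_top_of_le_ne_top hfin (measure_mono inter_subset_right)
  set T : ℝ≥0∞ := 2 ^ (q-1) with hT
  have hTt : T ≠ ∞ := by rw [hT]; finiteness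
  set CT : ℝ≥0∞ := T * (C2 + m⁻¹ * (T * (C1 + C2)) * μ S') with hCT
  have hCTt : CT ≠ ∞ := by
    have : m⁻¹ ≠ ∞ := ENNReal.inv_ne_top.mpr hpos
    rw [hCT]; finiteness
  refine ⟨CT.toNNReal, fun i => ?_⟩
  rw [ENNReal.coe_toNNReal hCTt]
  have hmeas : ∀ d : ℝ, Measurable (fun x => ‖f i x - d‖ₑ ^ q) := fun d =>
    (((hf i).sub_const d).enorm).pow_const q
  have hk : ‖c i - c' i‖ₑ ^ q ≤ m⁻¹ * (T * (C1 + C2)) * N i := by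
    have h3 : ‖c i - c' i‖ₑ ^ q * m ≤ T * (C1 * N i + C2 * N i) := by
      calc ‖c i - c' i‖ₑ ^ q * m = ∫⁻ x in S ∩ S', ‖c i - c' i‖ₑ ^ q ∂μ := by
            rw [setLIntegral_const]
        _ ≤ ∫⁻ x in S ∩ S', T * (‖f i x - c i‖ₑ ^ q + ‖f i x - c' i‖ₑ ^ q) ∂μ := by
            apply lintegral_mono
            intro x
            have := enorm_tri hq (c i) (c' i) (f i x)
            rwa [enorm_sub_rev (c i) (f i x), enorm_sub_rev (c' i) (f i x)] at this
        _ = T * (∫⁻ x in S ∩ S', ‖f i x - c i‖ₑ ^ q ∂μ +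
              ∫⁻ x in S ∩ S', ‖f i x - c' i‖ₑ ^ q ∂μ) := by
            rw [lintegral_const_mul' _ _ hTt, lintegral_add_left (hmeas _)]
        _ ≤ T * (C1 * N i + C2 * N i) := by
            gcongr
            · exact (lintegral_mono_set inter_subset_left).trans (h1 i)
            · exact (lintegral_mono_set inter_subset_right).trans (h2 i)
    calc ‖c i - c' i‖ₑ ^ q = m⁻¹ * (‖c i - c' i‖ₑ ^ q * m) := by
          rw [mul_comm _ m, ← mul_assoc, ENNReal.inv_mul_cancel hpos hmt, one_mul]
      _ ≤ m⁻¹ * (T * (C1 * N i + C2 * N i)) := by gcongr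
      _ = _ := by ring
  calc ∫⁻ x in S', ‖f i x - c i‖ₑ ^ q ∂μ
      ≤ ∫⁻ x in S', T * (‖f i x - c' i‖ₑ ^ q + ‖c i - c' i‖ₑ ^ q) ∂μ :=
        lintegral_mono fun x => enorm_tri hq _ _ _
    _ = T * (∫⁻ x in S', ‖f i x - c' i‖ₑ ^ q ∂μ + ‖c i - c' i‖ₑ ^ q * μ S') := by
        rw [lintegral_const_mul' _ _ hTt, lintegral_add_left (hmeas _), setLIntegral_const]
    _ ≤ T * (C2 * N i + m⁻¹ * (T * (C1 + C2)) * N i * μ S') := by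
        gcongr
        exact h2 i
    _ = CT * N i := by rw [hCT]; ring

variable {n : ℕ}

lemma sob_conn {p q : ℝ} (hn : 2 ≤ n) (hp : 1 < p) (hpq : p ≤ q)
    (h2 : 1 / p - 1 / q ≤ 1 / (n : ℝ)) {D K : Set (EuclideanSpace ℝ (Fin n))}
    (hDo : IsOpen D) (hDc : IsPreconnected D) (hK : IsCompact K) (hKD : K ⊆ D) :
    ∃ C : ℝ≥0, ∀ u : (EuclideanSpace ℝ (Fin n)) → ℝ, ContDiff ℝ 1 u → ∃ c : ℝ,
      ∫⁻ x in K, ‖u x - c‖ₑ ^ q ≤ C * (∫⁻ x in D, ‖fderiv ℝ u x‖ₑ ^ p) ^ (q/p) := by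
  have hq1 : 1 ≤ q := by linarith
  rcases D.eq_empty_or_nonempty with hDe | ⟨x0, hx0⟩
  · refine ⟨0, fun u _ => ⟨0, ?_⟩⟩
    have : K = ∅ := subset_empty_iff.mp (hDe ▸ hKD)
    simp [this]
  let ι := {u : (EuclideanSpace ℝ (Fin n)) → ℝ // ContDiff ℝ 1 u}
  let f : ι → (EuclideanSpace ℝ (Fin n)) → ℝ := fun i => i.1
  have hf : ∀ i, Measurable (f i) := fun i => i.2.continuous.measurable
  let N : ι → ℝ≥0∞ := fun i => (∫⁻ x in D, ‖fderiv ℝ (f i) x‖ₑ ^ p) ^ (q/p)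
  have hloc : ∀ y : D, ∃ r : ℝ, 0 < r ∧ ∃ c : ι → ℝ, ∃ C : ℝ≥0, ∀ i,
      ∫⁻ x in Metric.ball y.1 r, ‖f i x - c i‖ₑ ^ q ≤ C * N i := by
    intro y
    obtain ⟨ε, hε, hball⟩ := Metric.isOpen_iff.mp hDo y.1 y.2
    obtain ⟨C, hC⟩ := sob_ball hn hp hpq h2 y.1 (half_pos hε)
    have hC' : ∀ i : ι, ∃ c : ℝ, ∫⁻ x in Metric.ball y.1 (ε/2), ‖f i x - c‖ₑ ^ q ≤ C * N i := by
      intro i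
      obtain ⟨c, hc⟩ := hC i.1 i.2
      refine ⟨c, hc.trans ?_⟩
      rw [mul_div_cancel₀ _ (two_ne_zero)]
      gcongr
      exact ENNReal.rpow_le_rpow (lintegral_mono_set hball) (div_nonneg (by linarith) (by linarith))
    choose c hc using hC'
    exact ⟨ε/2, half_pos hε, c, C, hc⟩
  choose r hr c hc using hloc
  let c0 := c ⟨x0, hx0⟩
  let T : Set (EuclideanSpace ℝ (Fin n)) → Prop := fun S =>
    ∃ C : ℝ≥0, ∀ i, ∫⁻ x in S, ‖f i x - c0 i‖ₑ ^ q ≤ C * N i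
  have hstep : ∀ y z : D, ∀ w, w ∈ Metric.ball y.1 (r y) → w ∈ Metric.ball z.1 (r z) →
      T (Metric.ball y.1 (r y)) → T (Metric.ball z.1 (r z)) := by
    intro y z w hwy hwz hT
    refine overlap_bound volume hq1 f hf N c0 (c z) ?_ measure_ball_lt_top.ne hT (hc z)
    exact ((Metric.isOpen_ball.inter Metric.isOpen_ball).measure_pos volume ⟨w, hwy, hwz⟩).ne'
  let U : Set (EuclideanSpace ℝ (Fin n)) :=
    ⋃ y ∈ {y : D | T (Metric.ball y.1 (r y))}, Metric.ball y.1 (r y)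
  have hU : ∀ z : D, z.1 ∈ closure U → T (Metric.ball z.1 (r z)) := by
    intro z hz
    obtain ⟨w, hw1, hw2⟩ := mem_closure_iff.mp hz _ Metric.isOpen_ball
      (Metric.mem_ball_self (hr z))
    simp only [U, mem_iUnion] at hw2
    obtain ⟨y, hy, hwy⟩ := hw2
    exact hstep y z w hwy hw1 hy
  have hDU : D ⊆ U := by
    apply hDc.subset_of_closure_inter_subset
    · exact isOpen_biUnion fun _ _ => Metric.isOpen_ball
    · refine ⟨x0, hx0, ?_⟩
      simp only [U, mem_iUnion]
      exact ⟨⟨x0, hx0⟩, hc ⟨x0, hx0⟩, Metric.mem_ball_self (hr _)⟩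
    · rintro z ⟨hz1, hz2⟩
      simp only [U, mem_iUnion]
      exact ⟨⟨z, hz2⟩, hU ⟨z, hz2⟩ hz1, Metric.mem_ball_self (hr _)⟩
  have hTK : T K := by
    refine hK.induction_on (p := T) ?_ ?_ ?_ ?_
    · exact ⟨0, fun i => by simp⟩
    · rintro s t hst ⟨C, hC⟩
      exact ⟨C, fun i => (lintegral_mono_set hst).trans (hC i)⟩
    · rintro s t ⟨C, hC⟩ ⟨C', hC'⟩
      refine ⟨C + C', fun i => (lintegral_union_le _ _ _).trans ?_⟩
      push_cast
      rw [add_mul]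
      exact add_le_add (hC i) (hC' i)
    · intro x hx
      refine ⟨Metric.ball x (r ⟨x, hKD hx⟩), ?_, hU ⟨x, hKD hx⟩ (subset_closure (hDU (hKD hx)))⟩
      exact mem_nhdsWithin_of_mem_nhds (Metric.ball_mem_nhds _ (hr _))
  obtain ⟨C, hC⟩ := hTK
  exact ⟨C, fun u hu => ⟨c0 ⟨u, hu⟩, hC ⟨u, hu⟩⟩⟩

lemma annulus_preconn (hn : 2 ≤ n) :
    IsPreconnected {x : (EuclideanSpace ℝ (Fin n)) | 1/4 < ‖x‖ ∧ ‖x‖ < 2} := by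
  have hr : 1 < Module.rank ℝ (EuclideanSpace ℝ (Fin n)) := by
    rw [← Module.finrank_eq_rank, finrank_euclideanSpace, Fintype.card_fin]
    exact_mod_cast hn
  have h1 := isPreconnected_sphere hr (0 : EuclideanSpace ℝ (Fin n)) 1
  have h2 : IsPreconnected (Ioo (1/4:ℝ) 2) := isPreconnected_Ioo
  have h3 := (h2.prod h1).image (fun z : ℝ × (EuclideanSpace ℝ (Fin n)) => z.1 • z.2)
    (by fun_prop)
  convert h3 using 1
  ext x
  simp only [mem_ofPred_eq, mem_image, mem_prod, mem_Ioo, Metric.mem_sphere, dist_zero_right,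
    Prod.exists]
  constructor
  · intro ⟨hx1, hx2⟩
    have h0 : ‖x‖ ≠ 0 := by linarith
    refine ⟨‖x‖, ‖x‖⁻¹ • x, ⟨⟨hx1, hx2⟩, ?_⟩, ?_⟩
    · rw [norm_smul, norm_inv, norm_norm, inv_mul_cancel₀ h0]
    · rw [smul_smul, mul_inv_cancel₀ h0, one_smul]
  · rintro ⟨s, y, ⟨⟨hs1, hs2⟩, hy⟩, rfl⟩
    rw [norm_smul, hy, mul_one, Real.norm_of_nonneg (by linarith)]
    exact ⟨hs1, hs2⟩

lemma sob_annulus {p q : ℝ} (hn : 2 ≤ n) (hp : 1 < p) (hpq : p ≤ q)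
    (h2 : 1 / p - 1 / q ≤ 1 / (n : ℝ)) :
    ∃ C : ℝ≥0, ∀ u : (EuclideanSpace ℝ (Fin n)) → ℝ, ContDiff ℝ 1 u → ∃ c : ℝ,
      ∫⁻ x in {x : (EuclideanSpace ℝ (Fin n)) | 1/2 ≤ ‖x‖ ∧ ‖x‖ ≤ 1}, ‖u x - c‖ₑ ^ q ≤
        C * (∫⁻ x in {x : (EuclideanSpace ℝ (Fin n)) | 1/4 < ‖x‖ ∧ ‖x‖ < 2},
          ‖fderiv ℝ u x‖ₑ ^ p) ^ (q/p) := by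
  refine sob_conn hn hp hpq h2 ?_ (annulus_preconn hn) ?_ ?_
  · exact (isOpen_lt continuous_const continuous_norm).inter
      (isOpen_lt continuous_norm continuous_const)
  · apply (isCompact_closedBall (0 : EuclideanSpace ℝ (Fin n)) 1).of_isClosed_subset
    · exact (isClosed_le continuous_const continuous_norm).inter
        (isClosed_le continuous_norm continuous_const)
    · intro x hx
      simpa using hx.2
  · intro x hx
    exact ⟨by linarith [hx.1], by linarith [hx.2]⟩

end Part2a

section Part2b

open scoped ENNReal NNReal

variable {n : ℕ}

lemma polar (hn : 1 ≤ n) (f : (EuclideanSpace ℝ (Fin n)) → ℝ≥0∞) (hf : Measurable f) :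
    ∫⁻ x, f x = ∫⁻ σ : Metric.sphere (0 : EuclideanSpace ℝ (Fin n)) 1,
      ∫⁻ r in Ioi (0:ℝ), ENNReal.ofReal (r ^ (n-1)) * f (r • σ.1) ∂volume
      ∂(volume : Measure (EuclideanSpace ℝ (Fin n))).toSphere := by
  have : Nonempty (Fin n) := ⟨⟨0, hn⟩⟩
  have : Nontrivial (EuclideanSpace ℝ (Fin n)) := inferInstance
  have hmp := (volume : Measure (EuclideanSpace ℝ (Fin n))).measurePreserving_homeomorphUnitSphereProd
  let g : Metric.sphere (0 : EuclideanSpace ℝ (Fin n)) 1 × Ioi (0:ℝ) → ℝ≥0∞ :=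
    fun z => f (z.2.1 • z.1.1)
  have hgm : Measurable g := by
    apply hf.comp
    apply Continuous.measurable
    fun_prop
  have h1 := hmp.lintegral_comp_emb (Homeomorph.measurableEmbedding _) g
  have h2 : ∀ x : ({0}ᶜ : Set (EuclideanSpace ℝ (Fin n))),
      g (homeomorphUnitSphereProd (EuclideanSpace ℝ (Fin n)) x) = f x.1 := by
    intro x
    simp only [g]
    congr 1
    have hx : ‖x.1‖ ≠ 0 := norm_ne_zero_iff.mpr x.2
    simp [smul_smul, hx]
  simp only [h2] at h1
  rw [lintegral_subtype_comap (measurableSet_singleton _).compl f,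
    restrict_compl_singleton] at h1
  rw [h1, lintegral_prod _ hgm.aemeasurable]
  apply lintegral_congr
  intro σ
  rw [Measure.volumeIoiPow, lintegral_withDensity_eq_lintegral_mul]
  · simp only [Pi.mul_apply, g]
    rw [finrank_euclideanSpace, Fintype.card_fin]
    exact lintegral_subtype_comap measurableSet_Ioi
      (fun r : ℝ => ENNReal.ofReal (r ^ (n-1)) * f (r • σ.1))
  · fun_prop
  · exact hgm.comp (by fun_prop)

lemma polar_weight (hn : 1 ≤ n) (s : ℝ) (f : (EuclideanSpace ℝ (Fin n)) → ℝ≥0∞)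
    (hf : Measurable f) :
    ∫⁻ x, f x * ENNReal.ofReal (‖x‖ ^ s) =
      ∫⁻ σ : Metric.sphere (0 : EuclideanSpace ℝ (Fin n)) 1,
      ∫⁻ r in Ioi (0:ℝ), f (r • σ.1) * ENNReal.ofReal (r ^ (s + n - 1)) ∂volume
      ∂(volume : Measure (EuclideanSpace ℝ (Fin n))).toSphere := by
  rw [polar hn (fun x => f x * ENNReal.ofReal (‖x‖ ^ s)) (hf.mul (by fun_prop))]
  apply lintegral_congr
  intro σ
  apply setLIntegral_congr_fun measurableSet_Ioi
  intro r hr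
  have hr0 : 0 < r := hr
  have hσ : ‖σ.1‖ = 1 := by simp
  simp only
  rw [norm_smul, hσ, mul_one, Real.norm_of_nonneg hr0.le, mul_left_comm,
    ← ENNReal.ofReal_mul (by positivity)]
  congr 2
  rw [← Real.rpow_natCast, ← Real.rpow_add hr0]
  congr 1
  rw [Nat.cast_sub hn]
  push_cast
  ring

end Part2b

section Part2c

open scoped ENNReal NNReal

variable {n : ℕ}

lemma setLIntegral_scale (h : (EuclideanSpace ℝ (Fin n)) → ℝ≥0∞) (hh : Measurable h)
    {I : Set ℝ} (hI : MeasurableSet I) {l : ℝ} (hl : 0 < l) :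
    ∫⁻ x in {x : (EuclideanSpace ℝ (Fin n)) | l * ‖x‖ ∈ I}, h (l • x) =
      ENNReal.ofReal ((l ^ n)⁻¹) * ∫⁻ x in {x : (EuclideanSpace ℝ (Fin n)) | ‖x‖ ∈ I}, h x := by
  have hm1 : MeasurableSet {x : (EuclideanSpace ℝ (Fin n)) | l * ‖x‖ ∈ I} :=
    (by fun_prop : Measurable fun x : (EuclideanSpace ℝ (Fin n)) => l * ‖x‖) hI
  have hm2 : MeasurableSet {x : (EuclideanSpace ℝ (Fin n)) | ‖x‖ ∈ I} :=
    (by fun_prop : Measurable fun x : (EuclideanSpace ℝ (Fin n)) => ‖x‖) hI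
  rw [← lintegral_indicator hm1, ← lintegral_indicator hm2,
    ← lintegral_comp_affine _ (hh.indicator hm2) 0 hl]
  apply lintegral_congr
  intro x
  rw [zero_add]
  have hx : ‖l • x‖ = l * ‖x‖ := by rw [norm_smul, Real.norm_of_nonneg hl.le]
  by_cases hi : l * ‖x‖ ∈ I
  · rw [indicator_of_mem (by exact hi), indicator_of_mem (by simpa only [mem_ofPred_eq, hx] using hi)]
  · rw [indicator_of_notMem (by exact hi),
      indicator_of_notMem (by simpa only [mem_ofPred_eq, hx] using hi)]

lemma rpow_ratio_le {l r e : ℝ} (hl : 0 < l) (hr : 0 < r) (h1 : l ≤ 4 * r) (h2 : r ≤ 4 * l) :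
    l ^ e ≤ 4 ^ |e| * r ^ e := by
  have h3 : (l / r) ^ e ≤ 4 ^ |e| := by
    rcases le_or_gt 0 e with he | he
    · rw [abs_of_nonneg he]
      apply Real.rpow_le_rpow (by positivity) _ he
      rw [div_le_iff₀ hr]; exact h1
    · rw [abs_of_neg he]
      have : (l / r) ^ e = (r / l) ^ (-e) := by
        rw [Real.rpow_neg (by positivity), ← Real.inv_rpow (by positivity), inv_div]
      rw [this]
      apply Real.rpow_le_rpow (by positivity) _ (by linarith)
      rw [div_le_iff₀ hl]; exact h2
  rw [Real.div_rpow hl.le hr.le, div_le_iff₀ (by positivity)] at h3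
  exact h3

lemma sob_scaled {p q : ℝ} (hn : 2 ≤ n) (hp : 1 < p) (hpq : p ≤ q)
    (h2 : 1 / p - 1 / q ≤ 1 / (n : ℝ)) :
    ∃ C : ℝ≥0, ∀ u : (EuclideanSpace ℝ (Fin n)) → ℝ, ContDiff ℝ 1 u → ∀ l : ℝ, 0 < l → ∃ c : ℝ,
      ∫⁻ x in {x : (EuclideanSpace ℝ (Fin n)) | ‖x‖ ∈ Icc (l/2) l},
          ‖u x - c‖ₑ ^ q * ENNReal.ofReal (‖x‖ ^ (-(n:ℝ))) ≤
        C * (∫⁻ x in {x : (EuclideanSpace ℝ (Fin n)) | ‖x‖ ∈ Ioo (l/4) (2*l)},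
          ‖fderiv ℝ u x‖ₑ ^ p * ENNReal.ofReal (‖x‖ ^ (p - n))) ^ (q/p) := by
  have hp0 : 0 < p := by linarith
  have hq0 : 0 < q := by linarith
  have hqp : 0 ≤ q/p := by positivity
  obtain ⟨C, hC⟩ := sob_annulus hn hp hpq h2
  set M1 : ℝ := 4 ^ |(-(n:ℝ))| with hM1
  set M2 : ℝ := 4 ^ |p - n| with hM2
  have hM1p : 0 ≤ M1 := by positivity
  have hM2p : 0 ≤ M2 := by positivity
  set CT : ℝ≥0∞ := ENNReal.ofReal M1 * C * ENNReal.ofReal M2 ^ (q/p) with hCT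
  have hCTt : CT ≠ ∞ := by rw [hCT]; finiteness
  refine ⟨CT.toNNReal, fun u hu l hl => ?_⟩
  rw [ENNReal.coe_toNNReal hCTt]
  have hul : ContDiff ℝ 1 (fun x => u (l • x)) := hu.comp (contDiff_const_smul l)
  obtain ⟨c, hc⟩ := hC _ hul
  refine ⟨c, ?_⟩
  have hfd : ∀ x, ‖fderiv ℝ (fun x => u (l • x)) x‖ₑ ^ p =
      ENNReal.ofReal l ^ p * ‖fderiv ℝ u (l • x)‖ₑ ^ p := by
    intro x
    rw [fderiv_comp_smul, enorm_smul, ENNReal.mul_rpow_of_nonneg _ _ hp0.le, Real.enorm_of_nonneg hl.le]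
  have e1 : {x : (EuclideanSpace ℝ (Fin n)) | 1/2 ≤ ‖x‖ ∧ ‖x‖ ≤ 1} =
      {x : (EuclideanSpace ℝ (Fin n)) | l * ‖x‖ ∈ Icc (l/2) l} := by
    ext x
    simp only [mem_ofPred_eq, mem_Icc]
    constructor
    · rintro ⟨h, h'⟩; constructor <;> nlinarith
    · rintro ⟨h, h'⟩; constructor <;> nlinarith
  have e2 : {x : (EuclideanSpace ℝ (Fin n)) | 1/4 < ‖x‖ ∧ ‖x‖ < 2} =
      {x : (EuclideanSpace ℝ (Fin n)) | l * ‖x‖ ∈ Ioo (l/4) (2*l)} := by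
    ext x
    simp only [mem_ofPred_eq, mem_Ioo]
    constructor
    · rintro ⟨h, h'⟩; constructor <;> nlinarith
    · rintro ⟨h, h'⟩; constructor <;> nlinarith
  have hm1 : Measurable (fun x => ‖u x - c‖ₑ ^ q) :=
    ((hu.continuous.measurable.sub_const c).enorm).pow_const q
  have hm2 : Measurable (fun x => ‖fderiv ℝ u x‖ₑ ^ p) :=
    (hu.continuous_fderiv one_ne_zero).measurable.enorm.pow_const p
  simp only [hfd] at hc
  rw [lintegral_const_mul' _ _ (by finiteness), e1, e2,
    setLIntegral_scale (fun x => ‖u x - c‖ₑ ^ q) hm1 measurableSet_Icc hl,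
    setLIntegral_scale (fun x => ‖fderiv ℝ u x‖ₑ ^ p) hm2 measurableSet_Ioo hl] at hc
  have hcoef : ENNReal.ofReal l ^ p * ENNReal.ofReal ((l^n)⁻¹) = ENNReal.ofReal (l ^ (p - n)) := by
    rw [ENNReal.ofReal_rpow_of_pos hl, ← ENNReal.ofReal_mul (by positivity),
      Real.rpow_sub hl, Real.rpow_natCast, div_eq_mul_inv]
  rw [← mul_assoc, hcoef] at hc
  have hmI : MeasurableSet {x : (EuclideanSpace ℝ (Fin n)) | ‖x‖ ∈ Icc (l/2) l} :=
    measurable_norm measurableSet_Icc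
  have hmJ : MeasurableSet {x : (EuclideanSpace ℝ (Fin n)) | ‖x‖ ∈ Ioo (l/4) (2*l)} :=
    measurable_norm measurableSet_Ioo
  calc ∫⁻ x in {x : (EuclideanSpace ℝ (Fin n)) | ‖x‖ ∈ Icc (l/2) l},
          ‖u x - c‖ₑ ^ q * ENNReal.ofReal (‖x‖ ^ (-(n:ℝ)))
      ≤ ∫⁻ x in {x : (EuclideanSpace ℝ (Fin n)) | ‖x‖ ∈ Icc (l/2) l},
          (ENNReal.ofReal M1 * ENNReal.ofReal ((l^n)⁻¹)) * ‖u x - c‖ₑ ^ q := by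
        apply setLIntegral_mono' hmI
        rintro x ⟨hx1, hx2⟩
        rw [mul_comm]
        gcongr
        rw [← ENNReal.ofReal_mul hM1p, ← Real.rpow_natCast, ← Real.rpow_neg hl.le]
        apply ENNReal.ofReal_le_ofReal
        exact rpow_ratio_le (by linarith) hl (by linarith) (by linarith)
    _ = ENNReal.ofReal M1 * (ENNReal.ofReal ((l^n)⁻¹) *
          ∫⁻ x in {x : (EuclideanSpace ℝ (Fin n)) | ‖x‖ ∈ Icc (l/2) l}, ‖u x - c‖ₑ ^ q) := by
        rw [lintegral_const_mul' _ _ (by finiteness), mul_assoc]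
    _ ≤ ENNReal.ofReal M1 * (C * (ENNReal.ofReal (l ^ (p - n)) *
          ∫⁻ x in {x : (EuclideanSpace ℝ (Fin n)) | ‖x‖ ∈ Ioo (l/4) (2*l)},
            ‖fderiv ℝ u x‖ₑ ^ p) ^ (q/p)) := by gcongr
    _ ≤ ENNReal.ofReal M1 * (C * (ENNReal.ofReal M2 *
          ∫⁻ x in {x : (EuclideanSpace ℝ (Fin n)) | ‖x‖ ∈ Ioo (l/4) (2*l)},
            ‖fderiv ℝ u x‖ₑ ^ p * ENNReal.ofReal (‖x‖ ^ (p - n))) ^ (q/p)) := by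
        refine mul_le_mul_right (mul_le_mul_right (ENNReal.rpow_le_rpow ?_ hqp) _) _
        rw [← lintegral_const_mul' _ _ (by finiteness), ← lintegral_const_mul' _ _ (by finiteness)]
        apply setLIntegral_mono' hmJ
        rintro x ⟨hx1, hx2⟩
        rw [mul_left_comm, ← ENNReal.ofReal_mul hM2p, mul_comm]
        gcongr
        exact rpow_ratio_le hl (by linarith) (by linarith) (by linarith)
    _ = CT * _ := by
        rw [ENNReal.mul_rpow_of_nonneg _ _ hqp, hCT]; ring

lemma tsum_rpow_le {ι : Type*} (x : ι → ℝ≥0∞) {s : ℝ} (hs : 1 ≤ s) :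
    ∑' i, x i ^ s ≤ (∑' i, x i) ^ s := by
  have h : ∀ y : ℝ≥0∞, y ^ s = y * y ^ (s - 1) := by
    intro y
    have : s = 1 + (s - 1) := by ring
    conv_lhs => rw [this]
    rw [ENNReal.rpow_add_of_nonneg _ _ zero_le_one (by linarith), ENNReal.rpow_one]
  calc ∑' i, x i ^ s ≤ ∑' i, x i * (∑' i, x i) ^ (s - 1) := by
        apply ENNReal.tsum_le_tsum
        intro i
        rw [h]
        refine mul_le_mul_right (ENNReal.rpow_le_rpow (ENNReal.le_tsum i) (by linarith)) _
    _ = _ := by rw [ENNReal.tsum_mul_right, ← h]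

lemma dyadic_sum (g : (EuclideanSpace ℝ (Fin n)) → ℝ≥0∞) :
    ∑' m : ℤ, ∫⁻ x in {x : (EuclideanSpace ℝ (Fin n)) | ‖x‖ ∈ Ioo ((2:ℝ)^(m+1)/4) (2*(2:ℝ)^(m+1))}, g x
      ≤ 3 * ∫⁻ x, g x := by
  let A : ℤ → Set (EuclideanSpace ℝ (Fin n)) := fun m => {x | ‖x‖ ∈ Ioc ((2:ℝ)^m) ((2:ℝ)^(m+1))}
  have hA : ∀ m, MeasurableSet (A m) := fun m => measurable_norm measurableSet_Ioc
  have hdisj : Pairwise (Function.onFun Disjoint A) := by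
    have hmono : Monotone (fun m : ℤ => (2:ℝ)^m) := zpow_right_mono₀ (by norm_num)
    have := hmono.pairwise_disjoint_on_Ioc_succ
    intro i j hij
    exact (this hij).preimage (fun x : (EuclideanSpace ℝ (Fin n)) => ‖x‖)
  have hs : ∑' m, ∫⁻ x in A m, g x ≤ ∫⁻ x, g x := by
    rw [← lintegral_iUnion hA hdisj]
    exact setLIntegral_le_lintegral _ _
  have hsub : ∀ m : ℤ, {x : (EuclideanSpace ℝ (Fin n)) | ‖x‖ ∈ Ioo ((2:ℝ)^(m+1)/4) (2*(2:ℝ)^(m+1))}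
      ⊆ (A (m-1) ∪ A m) ∪ A (m+1) := by
    rintro m x ⟨h1, h2⟩
    have e1 : (2:ℝ)^(m+1) = 2 * 2^m := by rw [zpow_add₀ two_ne_zero]; ring
    have e2 : (2:ℝ)^(m+1+1) = 4 * 2^m := by rw [zpow_add₀ two_ne_zero, e1]; ring
    have e3 : (2:ℝ)^(m-1) = 2^m / 2 := by rw [zpow_sub₀ two_ne_zero]; simp
    rw [e1] at h1 h2
    simp only [A, mem_union, mem_ofPred_eq, mem_Ioc, e1, e2, e3, sub_add_cancel]
    rcases le_or_gt ‖x‖ (2^m) with h | h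
    · left; left; exact ⟨by linarith, h⟩
    · rcases le_or_gt ‖x‖ (2*2^m) with h' | h'
      · left; right; exact ⟨h, h'⟩
      · right; exact ⟨h', by linarith⟩
  calc _ ≤ ∑' m : ℤ, (((∫⁻ x in A (m-1), g x) + (∫⁻ x in A m, g x)) + (∫⁻ x in A (m+1), g x)) := by
        apply ENNReal.tsum_le_tsum
        intro m
        refine (lintegral_mono_set (hsub m)).trans ((lintegral_union_le _ _ _).trans ?_)
        exact add_le_add_left (lintegral_union_le _ _ _) _
    _ = ((∑' m, ∫⁻ x in A m, g x) + (∑' m, ∫⁻ x in A m, g x)) + (∑' m, ∫⁻ x in A m, g x) := by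
        rw [ENNReal.tsum_add, ENNReal.tsum_add]
        congr 1
        · congr 1
          exact (Equiv.subRight (1:ℤ)).tsum_eq (fun m => ∫⁻ x in A m, g x)
        · exact (Equiv.addRight (1:ℤ)).tsum_eq (fun m => ∫⁻ x in A m, g x)
    _ = 3 * ∑' m, ∫⁻ x in A m, g x := by ring
    _ ≤ _ := by gcongr

lemma polar_set (hn : 1 ≤ n) (s : ℝ) (F : (EuclideanSpace ℝ (Fin n)) → ℝ≥0∞) (hF : Measurable F)
    {I : Set ℝ} (hI : MeasurableSet I) (hI0 : I ⊆ Ioi 0) :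
    ∫⁻ σ : Metric.sphere (0 : EuclideanSpace ℝ (Fin n)) 1,
      (∫⁻ r in I, F (r • σ.1) * ENNReal.ofReal (r ^ (s + n - 1)))
      ∂(volume : Measure (EuclideanSpace ℝ (Fin n))).toSphere =
    ∫⁻ x in {x : (EuclideanSpace ℝ (Fin n)) | ‖x‖ ∈ I}, F x * ENNReal.ofReal (‖x‖ ^ s) := by
  have hA : MeasurableSet {x : (EuclideanSpace ℝ (Fin n)) | ‖x‖ ∈ I} := measurable_norm hI
  have hpol := polar_weight hn s _ (hF.indicator hA)
  have h3 : ∀ x, {x : (EuclideanSpace ℝ (Fin n)) | ‖x‖ ∈ I}.indicator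
      F x * ENNReal.ofReal (‖x‖ ^ s) =
      {x : (EuclideanSpace ℝ (Fin n)) | ‖x‖ ∈ I}.indicator
      (fun x => F x * ENNReal.ofReal (‖x‖ ^ s)) x := by
    intro x
    simp only [indicator]
    split_ifs <;> simp
  simp only [h3] at hpol
  rw [lintegral_indicator hA] at hpol
  rw [hpol]
  apply lintegral_congr
  intro σ
  have hσ : ‖σ.1‖ = 1 := by simp
  have hre : volume.restrict I = (volume.restrict (Ioi (0:ℝ))).restrict I := by
    rw [Measure.restrict_restrict hI, inter_eq_left.mpr hI0]
  rw [hre, ← lintegral_indicator hI]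
  apply setLIntegral_congr_fun measurableSet_Ioi
  intro r hr
  have hr0 : (0:ℝ) < r := hr
  have hx : ‖r • σ.1‖ = r := by
    rw [norm_smul, hσ, mul_one, Real.norm_of_nonneg hr0.le]
  simp only
  by_cases hi : r ∈ I
  · rw [indicator_of_mem (by exact hi),
      indicator_of_mem (by simpa only [mem_ofPred_eq, hx] using hi)]
  · rw [indicator_of_notMem (by exact hi),
      indicator_of_notMem (by simpa only [mem_ofPred_eq, hx] using hi), zero_mul]

lemma polar_cell (hn : 1 ≤ n) (F : (EuclideanSpace ℝ (Fin n)) → ℝ≥0∞) (hF : Measurable F)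
    {I : Set ℝ} (hI : MeasurableSet I) (hI0 : I ⊆ Ioi 0) :
    ∫⁻ σ : Metric.sphere (0 : EuclideanSpace ℝ (Fin n)) 1,
      (∫⁻ r in I, F (r • σ.1) * ENNReal.ofReal (r ^ (-1:ℝ)))
      ∂(volume : Measure (EuclideanSpace ℝ (Fin n))).toSphere =
    ∫⁻ x in {x : (EuclideanSpace ℝ (Fin n)) | ‖x‖ ∈ I}, F x * ENNReal.ofReal (‖x‖ ^ (-(n:ℝ))) := by
  have h := polar_set hn (-(n:ℝ)) F hF hI hI0
  have hexp : -(n:ℝ) + n - 1 = -1 := by ring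
  rw [hexp] at h
  exact h

lemma polar_ball (hn : 1 ≤ n) (F : (EuclideanSpace ℝ (Fin n)) → ℝ≥0∞) (hF : Measurable F)
    (η : ℝ) :
    ∫⁻ x in Metric.ball (0 : EuclideanSpace ℝ (Fin n)) η, F x * ENNReal.ofReal (‖x‖ ^ (1 - (n:ℝ))) =
    ∫⁻ σ : Metric.sphere (0 : EuclideanSpace ℝ (Fin n)) 1,
      (∫⁻ r in Ioo 0 η, F (r • σ.1))
      ∂(volume : Measure (EuclideanSpace ℝ (Fin n))).toSphere := by
  have h := polar_set hn (1 - (n:ℝ)) F hF (measurableSet_Ioo (a := 0) (b := η)) (fun r hr => hr.1)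
  have hexp : 1 - (n:ℝ) + n - 1 = 0 := by ring
  simp only [hexp, Real.rpow_zero, ENNReal.ofReal_one, mul_one] at h
  rw [h]
  have : Nonempty (Fin n) := ⟨⟨0, hn⟩⟩
  have hset : {x : (EuclideanSpace ℝ (Fin n)) | ‖x‖ ∈ Ioo 0 η} = Metric.ball 0 η \ {0} := by
    ext x
    simp only [mem_ofPred_eq, mem_Ioo, Set.mem_sdiff, Metric.mem_ball, dist_zero_right,
      mem_singleton_iff, norm_pos_iff]
    tauto
  rw [hset]
  apply setLIntegral_congr
  exact (sdiff_null_ae_eq_self (measure_singleton _)).symm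

lemma osc_cell_meas {q : ℝ} (u : (EuclideanSpace ℝ (Fin n)) → ℝ) (huc : Continuous u) (I : Set ℝ) :
    Measurable (fun z : Metric.sphere (0 : EuclideanSpace ℝ (Fin n)) 1 ×
      Metric.sphere (0 : EuclideanSpace ℝ (Fin n)) 1 =>
      ∫⁻ r in I, ‖u (r • z.2.1) - u (r • z.1.1)‖ₑ ^ q * ENNReal.ofReal (r ^ (-1:ℝ))) := by
  apply Measurable.lintegral_prod_right' (ν := volume.restrict I)
    (f := fun z : (Metric.sphere (0 : EuclideanSpace ℝ (Fin n)) 1 ×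
    Metric.sphere (0 : EuclideanSpace ℝ (Fin n)) 1) × ℝ =>
      ‖u (z.2 • z.1.2.1) - u (z.2 • z.1.1.1)‖ₑ ^ q * ENNReal.ofReal (z.2 ^ (-1:ℝ)))
  apply Measurable.mul
  · apply Measurable.pow_const
    apply Measurable.enorm
    apply Continuous.measurable
    fun_prop
  · fun_prop

lemma osc_cell {q : ℝ} (hq : 1 ≤ q) (u : (EuclideanSpace ℝ (Fin n)) → ℝ) (huc : Continuous u)
    (I : Set ℝ) (c : ℝ)
    (μS : Measure (Metric.sphere (0 : EuclideanSpace ℝ (Fin n)) 1)) [IsFiniteMeasure μS] :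
    ∫⁻ σ₀, (∫⁻ σ, (∫⁻ r in I, ‖u (r • σ.1) - u (r • σ₀.1)‖ₑ ^ q * ENNReal.ofReal (r ^ (-1:ℝ)))
      ∂μS) ∂μS ≤ 2 * 2 ^ (q-1) * μS univ *
        ∫⁻ σ, (∫⁻ r in I, ‖u (r • σ.1) - c‖ₑ ^ q * ENNReal.ofReal (r ^ (-1:ℝ))) ∂μS := by
  obtain ⟨e, he⟩ : ∃ e : Metric.sphere (0 : EuclideanSpace ℝ (Fin n)) 1 → ℝ≥0∞, e = fun σ =>
      ∫⁻ r in I, ‖u (r • σ.1) - c‖ₑ ^ q * ENNReal.ofReal (r ^ (-1:ℝ)) := ⟨_, rfl⟩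
  obtain ⟨T, hT⟩ : ∃ T : ℝ≥0∞, T = 2 ^ (q-1) := ⟨_, rfl⟩
  have hTt : T ≠ ∞ := by rw [hT]; finiteness
  have hSt : μS univ ≠ ∞ := measure_ne_top _ _
  have hem : Measurable e := by
    rw [he]
    apply Measurable.lintegral_prod_right' (ν := volume.restrict I)
      (f := fun z : Metric.sphere (0 : EuclideanSpace ℝ (Fin n)) 1 × ℝ =>
        ‖u (z.2 • z.1.1) - c‖ₑ ^ q * ENNReal.ofReal (z.2 ^ (-1:ℝ)))
    apply Measurable.mul
    · apply Measurable.pow_const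
      apply Measurable.enorm
      apply Continuous.measurable
      fun_prop
    · fun_prop
  have hpt : ∀ σ₀ σ : Metric.sphere (0 : EuclideanSpace ℝ (Fin n)) 1,
      (∫⁻ r in I, ‖u (r • σ.1) - u (r • σ₀.1)‖ₑ ^ q * ENNReal.ofReal (r ^ (-1:ℝ))) ≤
        T * (e σ + e σ₀) := by
    intro σ₀ σ
    rw [he]
    simp only
    rw [← lintegral_add_left, ← lintegral_const_mul' _ _ hTt]
    · apply lintegral_mono
      intro r
      simp only
      rw [← add_mul, ← mul_assoc, hT]
      exact mul_le_mul_left (enorm_tri hq _ _ _) _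
    · apply Measurable.mul
      · apply Measurable.pow_const
        apply Measurable.enorm
        apply Continuous.measurable
        fun_prop
      · fun_prop
  have hee : ∫⁻ σ, (∫⁻ r in I, ‖u (r • σ.1) - c‖ₑ ^ q * ENNReal.ofReal (r ^ (-1:ℝ))) ∂μS =
    ∫⁻ σ, e σ ∂μS := by rw [he]
  rw [hee, ← hT]
  calc _ ≤ ∫⁻ σ₀, ∫⁻ σ, T * (e σ + e σ₀) ∂μS ∂μS :=
        lintegral_mono fun σ₀ => lintegral_mono fun σ => hpt σ₀ σ
    _ = ∫⁻ σ₀, T * (∫⁻ σ, e σ ∂μS + e σ₀ * μS univ) ∂μS := by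
        apply lintegral_congr
        intro σ₀
        rw [lintegral_const_mul' _ _ hTt, lintegral_add_left hem, lintegral_const]
    _ = T * ((∫⁻ σ, e σ ∂μS) * μS univ + (∫⁻ σ, e σ ∂μS) * μS univ) := by
        rw [lintegral_const_mul' _ _ hTt, lintegral_add_left measurable_const, lintegral_const,
          lintegral_mul_const' _ _ hSt]
    _ = 2 * T * μS univ * ∫⁻ σ, e σ ∂μS := by ring

lemma osc {p q : ℝ} (hn : 2 ≤ n) (hp : 1 < p) (hpq : p ≤ q)
    (h2 : 1 / p - 1 / q ≤ 1 / (n : ℝ)) :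
    ∃ C : ℝ≥0, ∀ u : (EuclideanSpace ℝ (Fin n)) → ℝ, ContDiff ℝ 1 u →
      ∫⁻ σ₀ : Metric.sphere (0 : EuclideanSpace ℝ (Fin n)) 1,
      (∫⁻ σ : Metric.sphere (0 : EuclideanSpace ℝ (Fin n)) 1,
        (∫⁻ r in Ioi (0:ℝ), ‖u (r • σ.1) - u (r • σ₀.1)‖ₑ ^ q * ENNReal.ofReal (r ^ (-1:ℝ)))
        ∂(volume : Measure (EuclideanSpace ℝ (Fin n))).toSphere)
        ∂(volume : Measure (EuclideanSpace ℝ (Fin n))).toSphere ≤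
      C * (∫⁻ x, ‖fderiv ℝ u x‖ₑ ^ p * ENNReal.ofReal (‖x‖ ^ (p - n))) ^ (q/p) := by
  have hp0 : 0 < p := by linarith
  have hq0 : 0 < q := by linarith
  have hqp : 0 ≤ q/p := by positivity
  have hqp1 : 1 ≤ q/p := by rwa [one_le_div hp0]
  obtain ⟨C, hC⟩ := sob_scaled hn hp hpq h2
  have hfin : IsFiniteMeasure (volume : Measure (EuclideanSpace ℝ (Fin n))).toSphere := inferInstance
  generalize hμS : (volume : Measure (EuclideanSpace ℝ (Fin n))).toSphere = μS at hfin ⊢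
  have hSt : μS univ ≠ ∞ := measure_ne_top _ _
  obtain ⟨CT, hCT⟩ : ∃ CT : ℝ≥0∞, CT = 2 * 2 ^ (q-1) * μS univ * C * 3 ^ (q/p) := ⟨_, rfl⟩
  have hCTt : CT ≠ ∞ := by rw [hCT]; finiteness
  refine ⟨CT.toNNReal, fun u hu => ?_⟩
  rw [ENNReal.coe_toNNReal hCTt]
  have huc : Continuous u := hu.continuous
  obtain ⟨I, hIdef⟩ : ∃ I : ℤ → Set ℝ, I = fun m => Ioc ((2:ℝ)^m) ((2:ℝ)^(m+1)) := ⟨_, rfl⟩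
  obtain ⟨Y, hY⟩ : ∃ Y : ℤ → ℝ≥0∞, Y = fun m =>
    ∫⁻ x in {x : (EuclideanSpace ℝ (Fin n)) | ‖x‖ ∈ Ioo ((2:ℝ)^(m+1)/4) (2*(2:ℝ)^(m+1))},
      ‖fderiv ℝ u x‖ₑ ^ p * ENNReal.ofReal (‖x‖ ^ (p - n)) := ⟨_, rfl⟩
  obtain ⟨g, hg⟩ : ∃ g : ℤ → Metric.sphere (0 : EuclideanSpace ℝ (Fin n)) 1 →
      Metric.sphere (0 : EuclideanSpace ℝ (Fin n)) 1 → ℝ≥0∞, g = fun m σ₀ σ =>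
    ∫⁻ r in I m, ‖u (r • σ.1) - u (r • σ₀.1)‖ₑ ^ q * ENNReal.ofReal (r ^ (-1:ℝ)) := ⟨_, rfl⟩
  have hgm2 : ∀ m, Measurable (fun z : Metric.sphere (0 : EuclideanSpace ℝ (Fin n)) 1 ×
      Metric.sphere (0 : EuclideanSpace ℝ (Fin n)) 1 => g m z.1 z.2) := by
    intro m
    rw [hg]
    exact osc_cell_meas u huc (I m)
  have hgm1 : ∀ m σ₀, Measurable (g m σ₀) := fun m σ₀ =>
    (hgm2 m).comp (measurable_const.prodMk measurable_id)
  have hgm0 : ∀ m, Measurable (fun σ₀ => ∫⁻ σ, g m σ₀ σ ∂μS) := fun m =>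
    (hgm2 m).lintegral_prod_right'
  have hcell : ∀ m, ∫⁻ σ₀, ∫⁻ σ, g m σ₀ σ ∂μS ∂μS ≤
      2 * 2 ^ (q-1) * μS univ * C * Y m ^ (q/p) := by
    intro m
    obtain ⟨c, hc⟩ := hC u hu ((2:ℝ)^(m+1)) (by positivity)
    have hum : Measurable (fun x => ‖u x - c‖ₑ ^ q) :=
      ((huc.measurable.sub_const c).enorm).pow_const q
    have h1 := polar_cell (by omega : 1 ≤ n) _ hum (I := I m) (by rw [hIdef]; exact measurableSet_Ioc)
      (by rw [hIdef]; exact fun r hr => lt_trans (by positivity) hr.1)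
    have h3 := osc_cell (by linarith : 1 ≤ q) u huc (I m) c μS
    rw [hμS] at h1
    rw [h1] at h3
    rw [hg, hY]
    refine h3.trans ?_
    rw [mul_assoc _ (C:ℝ≥0∞)]
    refine mul_le_mul_right (le_trans (lintegral_mono_set ?_) hc) _
    rw [hIdef]
    rintro x ⟨hx1, hx2⟩
    refine ⟨?_, hx2⟩
    have e1 : (2:ℝ)^(m+1) = 2 * 2^m := by rw [zpow_add₀ two_ne_zero]; ring
    rw [e1]; linarith
  have hcover : Ioi (0:ℝ) ⊆ ⋃ m, I m := by
    intro r hr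
    obtain ⟨m, hm⟩ := exists_mem_Ioc_zpow (show (0:ℝ) < r from hr) (by norm_num : (1:ℝ) < 2)
    rw [hIdef]
    exact mem_iUnion.mpr ⟨m, hm⟩
  calc _ ≤ ∫⁻ σ₀, ∫⁻ σ, ∑' m, g m σ₀ σ ∂μS ∂μS := by
        apply lintegral_mono
        intro σ₀
        apply lintegral_mono
        intro σ
        rw [hg]
        exact (lintegral_mono_set hcover).trans (lintegral_iUnion_le _ _)
    _ = ∑' m, ∫⁻ σ₀, ∫⁻ σ, g m σ₀ σ ∂μS ∂μS := by
        rw [← lintegral_tsum fun m => (hgm0 m).aemeasurable]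
        apply lintegral_congr
        intro σ₀
        rw [← lintegral_tsum fun m => (hgm1 m σ₀).aemeasurable]
    _ ≤ ∑' m, 2 * 2 ^ (q-1) * μS univ * C * Y m ^ (q/p) := ENNReal.tsum_le_tsum hcell
    _ = 2 * 2 ^ (q-1) * μS univ * C * ∑' m, Y m ^ (q/p) := ENNReal.tsum_mul_left
    _ ≤ 2 * 2 ^ (q-1) * μS univ * C * (3 * ∫⁻ x, ‖fderiv ℝ u x‖ₑ ^ p *
          ENNReal.ofReal (‖x‖ ^ (p - n))) ^ (q/p) := by
        refine mul_le_mul_right ((tsum_rpow_le Y hqp1).trans ?_) _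
        rw [hY]
        exact ENNReal.rpow_le_rpow (dyadic_sum _) hqp
    _ = _ := by
        rw [ENNReal.mul_rpow_of_nonneg _ _ hqp, hCT]; ring

end Part2c

section Assembly
open scoped ENNReal NNReal

/-- Hypotheses on weights and test function used in the core inequality. -/
structure WHyp (n : ℕ) (η δ₁ δ₂ : ℝ) (w s : ℝ → ℝ) (u : EuclideanSpace ℝ (Fin n) → ℝ) : Prop where
  d1 : 0 < δ₁
  d12 : δ₁ ≤ δ₂
  d2 : δ₂ < η
  wm : Measurable w
  sm : Measurable s
  wc : ContinuousOn w (Ioo 0 η)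
  wge : ∀ t ∈ Ioo 0 η, t ≤ w t
  sd : ∀ t ∈ Ioo 0 η, HasDerivAt s (-1 / w t) t
  s1 : ∀ t ∈ Ioo 0 η, 1 ≤ s t
  uc : ContDiff ℝ 1 u
  u1 : ∀ x, ‖x‖ ≤ δ₁ → u x = 0
  u2 : ∀ x, δ₂ ≤ ‖x‖ → u x = 0

/-- gradient density -/
noncomputable def Gd {n : ℕ} (p : ℝ) (w : ℝ → ℝ) (u : EuclideanSpace ℝ (Fin n) → ℝ)
    (x : EuclideanSpace ℝ (Fin n)) : ℝ≥0∞ :=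
  ENNReal.ofReal (‖fderiv ℝ u x‖ ^ p * w ‖x‖ ^ (p - 1))

/-- right side density -/
noncomputable def Rd {n : ℕ} (p q : ℝ) (w s : ℝ → ℝ) (u : EuclideanSpace ℝ (Fin n) → ℝ)
    (x : EuclideanSpace ℝ (Fin n)) : ℝ≥0∞ :=
  ENNReal.ofReal (|u x| ^ q / (w ‖x‖ * s ‖x‖ ^ (1 + q / (p / (p - 1)))))

variable {n : ℕ} {η δ₁ δ₂ : ℝ} {w s : ℝ → ℝ} {u : EuclideanSpace ℝ (Fin n) → ℝ}

lemma Gd_meas (H : WHyp n η δ₁ δ₂ w s u) (p : ℝ) : Measurable (Gd p w u) := by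
  have h1 : Measurable (fun x => ‖fderiv ℝ u x‖) := (H.uc.continuous_fderiv (by norm_num)).norm.measurable
  have h2 : Measurable (fun x : EuclideanSpace ℝ (Fin n) => w ‖x‖) := H.wm.comp measurable_norm
  exact ((h1.pow_const p).mul (h2.pow_const (p-1))).ennreal_ofReal

lemma Rd_meas (H : WHyp n η δ₁ δ₂ w s u) (p q : ℝ) : Measurable (Rd p q w s u) := by
  have h1 : Measurable (fun x => |u x|) := H.uc.continuous.abs.measurable
  have h2 : Measurable (fun x : EuclideanSpace ℝ (Fin n) => w ‖x‖) := H.wm.comp measurable_norm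
  have h3 : Measurable (fun x : EuclideanSpace ℝ (Fin n) => s ‖x‖) := H.sm.comp measurable_norm
  exact ((h1.pow_const q).div (h2.mul (h3.pow_const _))).ennreal_ofReal

lemma norm_ray (σ : Metric.sphere (0 : EuclideanSpace ℝ (Fin n)) 1) {r : ℝ} (hr : 0 < r) :
    ‖r • σ.1‖ = r := by
  have : ‖σ.1‖ = 1 := by simp
  rw [norm_smul, this, mul_one, Real.norm_of_nonneg hr.le]

lemma ray {p q : ℝ} (hp : 1 < p) (hpq : p ≤ q) : ∃ C : ℝ, 0 < C ∧
    ∀ {n : ℕ} {η δ₁ δ₂ : ℝ} {w s : ℝ → ℝ} {u : EuclideanSpace ℝ (Fin n) → ℝ},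
    WHyp n η δ₁ δ₂ w s u → ∀ (σ : Metric.sphere (0 : EuclideanSpace ℝ (Fin n)) 1) {G : ℝ}, 0 < G →
    (∫⁻ r in Ioo 0 η, Gd p w u (r • σ.1)) ≤ ENNReal.ofReal G →
    (∫⁻ r in Ioo 0 η, Rd p q w s u (r • σ.1)) ≤ ENNReal.ofReal (C * G ^ (q/p)) := by
  obtain ⟨C, hC, h⟩ := oneD hp hpq
  refine ⟨C, hC, ?_⟩
  intro n η δ₁ δ₂ w s u H σ G hG hGi
  have hσ : ‖σ.1‖ = 1 := by simp
  have hcf : Continuous (fun r : ℝ => fderiv ℝ u (r • σ.1) σ.1) := by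
    have := H.uc.continuous_fderiv (by norm_num)
    have h3 : Continuous (fun r : ℝ => fderiv ℝ u (r • σ.1)) := this.comp (by fun_prop)
    exact h3.clm_apply continuous_const
  have hder : ∀ r : ℝ, HasDerivAt (fun r : ℝ => u (r • σ.1)) (fderiv ℝ u (r • σ.1) σ.1) r := by
    intro r
    have h1 : HasFDerivAt u (fderiv ℝ u (r • σ.1)) (r • σ.1) :=
      (H.uc.differentiable (by norm_num) _).hasFDerivAt
    have h2 : HasDerivAt (fun r : ℝ => r • σ.1) σ.1 r := by
      simpa using (hasDerivAt_id r).smul_const σ.1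
    exact h1.comp_hasDerivAt r h2
  have := h (η := η) (w := w) (s := s) H.d1 H.d12 H.d2 H.wc (fun x hx => hx.1.trans_le (H.wge x hx)) H.sd H.s1 hder hcf
    (fun x hx hx2 => H.u1 _ (by rw [norm_ray σ hx]; exact hx2))
    (fun x hx => H.u2 _ (by rw [norm_ray σ (H.d1.trans_le (H.d12.trans hx))]; exact hx)) hG ?_
  · refine le_trans (le_of_eq ?_) this
    refine setLIntegral_congr_fun measurableSet_Ioo fun r hr => ?_
    simp only [Rd, norm_ray σ hr.1]
  · refine le_trans (setLIntegral_mono' measurableSet_Ioo fun r hr => ?_) hGi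
    simp only [Gd, norm_ray σ hr.1]
    have hw := hr.1.trans_le (H.wge r hr)
    refine ENNReal.ofReal_le_ofReal (mul_le_mul_of_nonneg_right ?_ (by positivity))
    refine Real.rpow_le_rpow (abs_nonneg _) ?_ (by linarith)
    have := (fderiv ℝ u (r • σ.1)).le_opNorm σ.1
    rwa [hσ, mul_one] at this

lemma fderiv_zero_out (H : WHyp n η δ₁ δ₂ w s u) {x : EuclideanSpace ℝ (Fin n)}
    (hx : ‖x‖ < δ₁ ∨ δ₂ < ‖x‖) : fderiv ℝ u x = 0 := by
  have : u =ᶠ[𝓝 x] fun _ => 0 := by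
    rcases hx with hx | hx
    · filter_upwards [(isOpen_lt continuous_norm continuous_const).mem_nhds hx] with y hy
      exact H.u1 y (le_of_lt hy)
    · filter_upwards [(isOpen_lt continuous_const continuous_norm).mem_nhds hx] with y hy
      exact H.u2 y (le_of_lt hy)
  rw [this.fderiv_eq]; simp

lemma grad_bound (H : WHyp n η δ₁ δ₂ w s u) {p : ℝ} (hp : 1 < p) :
    (∫⁻ x, ‖fderiv ℝ u x‖ₑ ^ p * ENNReal.ofReal (‖x‖ ^ (p - n))) ≤
    ∫⁻ x in Metric.ball (0 : EuclideanSpace ℝ (Fin n)) η,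
      Gd p w u x * ENNReal.ofReal (‖x‖ ^ (1 - (n:ℝ))) := by
  rw [← lintegral_indicator Metric.isOpen_ball.measurableSet]
  refine lintegral_mono fun x => ?_
  by_cases hx : ‖x‖ < δ₁ ∨ δ₂ < ‖x‖
  · rw [← ofReal_norm, fderiv_zero_out H hx, norm_zero, ENNReal.ofReal_zero, ENNReal.zero_rpow_of_pos (by linarith), zero_mul]; exact zero_le
  · push Not at hx
    have hm : x ∈ Metric.ball (0 : EuclideanSpace ℝ (Fin n)) η := by
      simpa using hx.2.trans_lt H.d2
    have h0 : 0 < ‖x‖ := H.d1.trans_le hx.1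
    rw [indicator_of_mem hm, Gd]
    have hw := H.wge ‖x‖ ⟨h0, hx.2.trans_lt H.d2⟩
    have hw0 := h0.trans_le hw
    rw [← ofReal_norm, ENNReal.ofReal_rpow_of_nonneg (norm_nonneg _) (by linarith),
      ← ENNReal.ofReal_mul (by positivity), ← ENNReal.ofReal_mul (by positivity), mul_assoc]
    refine ENNReal.ofReal_le_ofReal (mul_le_mul_of_nonneg_left ?_ (by positivity))
    have : ‖x‖ ^ (p - n) = ‖x‖ ^ (p-1) * ‖x‖ ^ (1 - (n:ℝ)) := by
      rw [← Real.rpow_add h0]; ring_nf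
    rw [this]
    exact mul_le_mul_of_nonneg_right (Real.rpow_le_rpow h0.le hw (by linarith)) (by positivity)

lemma Rd_tri (H : WHyp n η δ₁ δ₂ w s u) {p q : ℝ} (hp : 1 < p) (hpq : p ≤ q)
    (σ σ₀ : Metric.sphere (0 : EuclideanSpace ℝ (Fin n)) 1) {r : ℝ} (hr : r ∈ Ioo 0 η) :
    Rd p q w s u (r • σ.1) ≤ 2 ^ (q-1) * (‖u (r • σ.1) - u (r • σ₀.1)‖ₑ ^ q * ENNReal.ofReal (r ^ (-1:ℝ))
      + Rd p q w s u (r • σ₀.1)) := by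
  have hw := H.wge r hr
  have hw0 := hr.1.trans_le hw
  have hs := H.s1 r hr
  have hs0 : 0 < s r := by linarith
  obtain ⟨e, he⟩ : ∃ e, e = (1 + q / (p / (p - 1))) := ⟨_, rfl⟩
  have he0 : 0 ≤ e := by
    rw [he]; have : 0 < p - 1 := by linarith
    have hq : 0 < q := by linarith
    positivity
  have hse : 1 ≤ s r ^ e := Real.one_le_rpow hs he0
  have key : ∀ τ : Metric.sphere (0 : EuclideanSpace ℝ (Fin n)) 1, Rd p q w s u (r • τ.1) =
      ‖u (r • τ.1)‖ₑ ^ q * ENNReal.ofReal ((w r * s r ^ e)⁻¹) := by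
    intro τ
    rw [Rd, norm_ray τ hr.1, ← he, div_eq_mul_inv, ENNReal.ofReal_mul (by positivity),
      ← ENNReal.ofReal_rpow_of_nonneg (abs_nonneg _) (by linarith), ← Real.norm_eq_abs, ofReal_norm]
  rw [key σ, key σ₀]
  have h1 := enorm_tri (q := q) (by linarith) (u (r • σ.1)) 0 (u (r • σ₀.1))
  rw [sub_zero, zero_sub, enorm_neg] at h1
  refine (mul_le_mul_left h1 _).trans ?_
  rw [mul_assoc, add_mul]
  refine mul_le_mul_right (add_le_add_left (mul_le_mul_right ?_ _) _) _
  refine ENNReal.ofReal_le_ofReal ?_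
  rw [Real.rpow_neg_one]
  refine inv_anti₀ hr.1 ?_
  nlinarith

lemma core_two {p q : ℝ} (hn : 2 ≤ n) (hp : 1 < p) (hpq : p ≤ q)
    (h2 : 1 / p - 1 / q ≤ 1 / (n : ℝ)) : ∃ C : ℝ, 0 < C ∧
    ∀ {η δ₁ δ₂ : ℝ} {w s : ℝ → ℝ} {u : EuclideanSpace ℝ (Fin n) → ℝ},
    WHyp n η δ₁ δ₂ w s u → ∀ {G : ℝ}, 0 < G →
    (∫⁻ x in Metric.ball (0 : EuclideanSpace ℝ (Fin n)) η,
      Gd p w u x * ENNReal.ofReal (‖x‖ ^ (1 - (n:ℝ)))) ≤ ENNReal.ofReal G →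
    (∫⁻ x in Metric.ball (0 : EuclideanSpace ℝ (Fin n)) η,
      Rd p q w s u x * ENNReal.ofReal (‖x‖ ^ (1 - (n:ℝ)))) ≤ ENNReal.ofReal (C * G ^ (q/p)) := by
  obtain ⟨C1, hC1, hray⟩ := ray hp hpq
  obtain ⟨Co, hosc⟩ := osc hn hp hpq h2
  obtain ⟨μ, hμ⟩ : ∃ μ, μ = (volume : Measure (EuclideanSpace ℝ (Fin n))).toSphere := ⟨_, rfl⟩
  have : Nonempty (Fin n) := ⟨⟨0, by omega⟩⟩
  have : IsFiniteMeasure μ := by rw [hμ]; infer_instance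
  have hμ0 : μ ≠ 0 := by rw [hμ]; exact Measure.toSphere_ne_zero _
  have hm0 : μ univ ≠ 0 := by simpa using hμ0
  have hmt : μ univ ≠ ⊤ := measure_ne_top _ _
  obtain ⟨m, hm⟩ : ∃ m : ℝ≥0, (m : ℝ≥0∞) = μ univ := ⟨(μ univ).toNNReal, ENNReal.coe_toNNReal hmt⟩
  have hmpos : 0 < m := by
    rw [pos_iff_ne_zero]; rintro rfl; exact hm0 (by rw [← hm]; rfl)
  obtain ⟨A, hA⟩ : ∃ A : ℝ≥0, A = (1 + Co) / m := ⟨_, rfl⟩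
  have hApos : 0 < A := by rw [hA]; positivity
  refine ⟨2 ^ (q-1) * (A + m * (C1 * A ^ (q/p))), by positivity, ?_⟩
  intro η δ₁ δ₂ w s u H G hG hGi
  have hgrad := (grad_bound H hp).trans hGi
  have hqp : 0 ≤ q / p := by
    have : 0 < q := by linarith
    positivity
  rw [polar_ball (by omega) _ (Gd_meas H p), ← hμ] at hGi
  rw [polar_ball (by omega) _ (Rd_meas H p q), ← hμ]
  have ho := (hosc u H.uc).trans (mul_le_mul_right (ENNReal.rpow_le_rpow hgrad hqp) _)
  rw [← hμ, ENNReal.ofReal_rpow_of_nonneg hG.le hqp] at ho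
  obtain ⟨Gf, hGf⟩ : ∃ Gf : Metric.sphere (0 : EuclideanSpace ℝ (Fin n)) 1 → ℝ≥0∞,
      Gf = fun σ => ∫⁻ r in Ioo 0 η, Gd p w u (r • σ.1) := ⟨_, rfl⟩
  obtain ⟨Hf, hHf⟩ : ∃ Hf : Metric.sphere (0 : EuclideanSpace ℝ (Fin n)) 1 → ℝ≥0∞,
      Hf = fun σ₀ => ∫⁻ σ : Metric.sphere (0 : EuclideanSpace ℝ (Fin n)) 1,
        (∫⁻ r in Ioi (0:ℝ), ‖u (r • σ.1) - u (r • σ₀.1)‖ₑ ^ q * ENNReal.ofReal (r ^ (-1:ℝ))) ∂μ := ⟨_, rfl⟩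
  have hGm : Measurable Gf := by
    rw [hGf]
    have : Measurable (fun z : Metric.sphere (0 : EuclideanSpace ℝ (Fin n)) 1 × ℝ => Gd p w u (z.2 • z.1.1)) :=
      (Gd_meas H p).comp (by fun_prop)
    exact this.lintegral_prod_right'
  have hHm : Measurable Hf := by
    rw [hHf]
    exact (osc_cell_meas u H.uc.continuous (Ioi 0)).lintegral_prod_right'
  have hGi' : ∫⁻ σ, Gf σ ∂μ ≤ ENNReal.ofReal G := by rw [hGf]; exact hGi
  have ho' : ∫⁻ σ, Hf σ ∂μ ≤ Co * ENNReal.ofReal (G ^ (q/p)) := by rw [hHf]; exact ho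
  have hg0 : ENNReal.ofReal G ≠ 0 := by simpa using hG
  have hGq : 0 < G ^ (q/p) := by positivity
  have hgq0 : ENNReal.ofReal (G ^ (q/p)) ≠ 0 := by simpa using hGq
  obtain ⟨σ₀, hσ₀⟩ : ∃ σ₀, Gf σ₀ * (ENNReal.ofReal G)⁻¹ + Hf σ₀ * (ENNReal.ofReal (G ^ (q/p)))⁻¹ ≤ A := by
    obtain ⟨σ₀, h⟩ := exists_le_laverage (μ := μ) (f := fun σ => Gf σ * (ENNReal.ofReal G)⁻¹ + Hf σ * (ENNReal.ofReal (G ^ (q/p)))⁻¹)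
      hμ0 ((hGm.mul_const _).add (hHm.mul_const _)).aemeasurable
    refine ⟨σ₀, h.trans ?_⟩
    rw [laverage_eq, lintegral_add_left (hGm.mul_const _), lintegral_mul_const _ hGm, lintegral_mul_const _ hHm,
      ← hm, hA, ENNReal.coe_div hmpos.ne', ENNReal.coe_add]
    refine ENNReal.div_le_div_right (add_le_add ?_ ?_) _
    · refine (mul_le_mul_left hGi' _).trans ?_
      rw [ENNReal.mul_inv_cancel hg0 ENNReal.ofReal_ne_top]; rfl
    · refine (mul_le_mul_left ho' _).trans ?_
      rw [mul_assoc, ENNReal.mul_inv_cancel hgq0 ENNReal.ofReal_ne_top, mul_one]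
  have hG1 : Gf σ₀ ≤ ENNReal.ofReal (A * G) := by
    have := (le_add_right le_rfl).trans hσ₀
    rw [← div_eq_mul_inv, ENNReal.div_le_iff hg0 ENNReal.ofReal_ne_top] at this
    rwa [ENNReal.ofReal_mul (by positivity), ENNReal.ofReal_coe_nnreal]
  have hH1 : Hf σ₀ ≤ A * ENNReal.ofReal (G ^ (q/p)) := by
    have := (le_add_left le_rfl).trans hσ₀
    rwa [← div_eq_mul_inv, ENNReal.div_le_iff hgq0 ENNReal.ofReal_ne_top] at this
  have hR := hray H σ₀ (G := A * G) (by positivity) (by rw [hGf] at hG1; exact hG1)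
  have hpt : ∀ σ : Metric.sphere (0 : EuclideanSpace ℝ (Fin n)) 1, (∫⁻ r in Ioo 0 η, Rd p q w s u (r • σ.1)) ≤
      2 ^ (q-1) * ((∫⁻ r in Ioi (0:ℝ), ‖u (r • σ.1) - u (r • σ₀.1)‖ₑ ^ q * ENNReal.ofReal (r ^ (-1:ℝ))) +
        ENNReal.ofReal (C1 * (A * G) ^ (q/p))) := by
    intro σ
    refine (setLIntegral_mono' measurableSet_Ioo fun r hr => Rd_tri H hp hpq σ σ₀ hr).trans ?_
    have hmR : Measurable (fun r : ℝ => Rd p q w s u (r • σ₀.1)) := (Rd_meas H p q).comp (by fun_prop)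
    rw [lintegral_const_mul' _ _ (by simp), lintegral_add_right _ hmR]
    exact mul_le_mul_right (add_le_add (lintegral_mono_set Ioo_subset_Ioi_self) hR) _
  refine (lintegral_mono hpt).trans ?_
  rw [lintegral_const_mul' _ _ (by simp), lintegral_add_right _ measurable_const, lintegral_const, ← hm]
  have hH2 := hH1
  rw [hHf] at hH2
  refine (mul_le_mul_right (add_le_add_left hH2 _) _).trans (le_of_eq ?_)
  have e1 : (2 : ℝ≥0∞) ^ (q-1) = ENNReal.ofReal (2 ^ (q-1)) := by
    rw [← ENNReal.ofReal_rpow_of_pos (by norm_num)]; norm_num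
  rw [e1, ← ENNReal.ofReal_coe_nnreal, ← ENNReal.ofReal_coe_nnreal, ← ENNReal.ofReal_mul (by positivity),
    ← ENNReal.ofReal_mul (by positivity), ← ENNReal.ofReal_add (by positivity) (by positivity),
    ← ENNReal.ofReal_mul (by positivity), Real.mul_rpow (by positivity) hG.le]
  congr 1; ring

lemma sphere_one_ball (σ : Metric.sphere (0 : EuclideanSpace ℝ (Fin 1)) 1) : Metric.ball σ 1 = {σ} := by
  ext τ
  simp only [Metric.mem_ball, mem_singleton_iff]
  refine ⟨fun h => ?_, fun h => by rw [h]; simp⟩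
  have h1 : ‖σ.1‖ = 1 := by simp
  have h2 : ‖τ.1‖ = 1 := by simp
  rw [Subtype.dist_eq, dist_eq_norm] at h
  rw [EuclideanSpace.norm_eq] at h h1 h2
  simp only [Fin.sum_univ_one, Real.sqrt_sq_eq_abs, PiLp.sub_apply, Real.norm_eq_abs, abs_abs, sq_abs] at h h1 h2
  apply Subtype.ext
  ext i
  rw [Subsingleton.elim i 0]
  rcases (abs_eq (by norm_num)).1 h1 with h1 | h1 <;> rcases (abs_eq (by norm_num)).1 h2 with h2 | h2 <;>
    rw [h1, h2] at h <;> norm_num at h <;> rw [h1, h2]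

lemma core_one {p q : ℝ} (hp : 1 < p) (hpq : p ≤ q) : ∃ C : ℝ, 0 < C ∧
    ∀ {η δ₁ δ₂ : ℝ} {w s : ℝ → ℝ} {u : EuclideanSpace ℝ (Fin 1) → ℝ},
    WHyp 1 η δ₁ δ₂ w s u → ∀ {G : ℝ}, 0 < G →
    (∫⁻ x in Metric.ball (0 : EuclideanSpace ℝ (Fin 1)) η,
      Gd p w u x * ENNReal.ofReal (‖x‖ ^ (1 - ((1:ℕ):ℝ)))) ≤ ENNReal.ofReal G →
    (∫⁻ x in Metric.ball (0 : EuclideanSpace ℝ (Fin 1)) η,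
      Rd p q w s u x * ENNReal.ofReal (‖x‖ ^ (1 - ((1:ℕ):ℝ)))) ≤ ENNReal.ofReal (C * G ^ (q/p)) := by
  obtain ⟨C1, hC1, hray⟩ := ray hp hpq
  obtain ⟨μ, hμ⟩ : ∃ μ, μ = (volume : Measure (EuclideanSpace ℝ (Fin 1))).toSphere := ⟨_, rfl⟩
  have : IsFiniteMeasure μ := by rw [hμ]; infer_instance
  have hμ0 : μ ≠ 0 := by rw [hμ]; exact Measure.toSphere_ne_zero _
  have hm0 : μ univ ≠ 0 := by simpa using hμ0
  have hmt : μ univ ≠ ⊤ := measure_ne_top _ _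
  obtain ⟨m, hm⟩ : ∃ m : ℝ≥0, (m : ℝ≥0∞) = μ univ := ⟨(μ univ).toNNReal, ENNReal.coe_toNNReal hmt⟩
  have hmpos : 0 < m := by
    rw [pos_iff_ne_zero]; rintro rfl; exact hm0 (by rw [← hm]; rfl)
  obtain ⟨b, hb, hbσ⟩ : ∃ b : ℝ≥0, 0 < b ∧ ∀ σ, (b : ℝ≥0∞) ≤ μ {σ} := by
    obtain ⟨c, hc⟩ : ∃ c : ℝ≥0∞, c = Measure.toSphereBallBound (Module.finrank ℝ (EuclideanSpace ℝ (Fin 1))) 1 * (volume : Measure (EuclideanSpace ℝ (Fin 1))) (Metric.ball 0 1) := ⟨_, rfl⟩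
    have hc1 : ∀ σ, c ≤ μ {σ} := by
      intro σ
      rw [hc, hμ, ← sphere_one_ball σ]
      exact Measure.toSphereBallBound_mul_measure_unitBall_le_toSphere_ball _ (by norm_num) σ
    have hc0 : c ≠ 0 := by
      rw [hc]
      refine mul_ne_zero ?_ (Metric.measure_ball_pos _ _ (by norm_num)).ne'
      exact_mod_cast (Measure.toSphereBallBound_pos _ _).ne'
    obtain ⟨b, hb0, hb⟩ := ENNReal.lt_iff_exists_nnreal_btwn.1 (pos_iff_ne_zero.2 hc0)
    exact ⟨b, by exact_mod_cast hb0, fun σ => hb.le.trans (hc1 σ)⟩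
  refine ⟨m * (C1 * (b⁻¹ : ℝ≥0) ^ (q/p)), by positivity, ?_⟩
  intro η δ₁ δ₂ w s u H G hG hGi
  rw [polar_ball le_rfl _ (Gd_meas H p), ← hμ] at hGi
  rw [polar_ball le_rfl _ (Rd_meas H p q), ← hμ]
  have hpt : ∀ σ : Metric.sphere (0 : EuclideanSpace ℝ (Fin 1)) 1, (∫⁻ r in Ioo 0 η, Rd p q w s u (r • σ.1)) ≤
        ENNReal.ofReal (C1 * ((b⁻¹ : ℝ≥0) * G) ^ (q/p)) := by
    intro σ
    refine hray H σ (by positivity) ?_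
    have h1 := (setLIntegral_le_lintegral {σ} (fun σ : Metric.sphere (0 : EuclideanSpace ℝ (Fin 1)) 1 => ∫⁻ r in Ioo 0 η, Gd p w u (r • σ.1)) (μ := μ)).trans hGi
    rw [lintegral_singleton] at h1
    have h2 := (mul_le_mul_right (hbσ σ) _).trans h1
    rw [← ENNReal.le_div_iff_mul_le (by simp [hb.ne']) (by simp)] at h2
    refine h2.trans (le_of_eq ?_)
    rw [ENNReal.ofReal_mul (by positivity), ENNReal.ofReal_coe_nnreal, ENNReal.coe_inv hb.ne', mul_comm, div_eq_mul_inv]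
  refine (lintegral_mono hpt).trans (le_of_eq ?_)
  rw [lintegral_const, ← hm, ← ENNReal.ofReal_coe_nnreal, ← ENNReal.ofReal_mul (by positivity), Real.mul_rpow (by positivity) hG.le]
  congr 1; ring

lemma core {p q : ℝ} (hn : 1 ≤ n) (hp : 1 < p) (hpq : p ≤ q)
    (h2 : 1 / p - 1 / q ≤ 1 / (n : ℝ)) : ∃ C : ℝ, 0 < C ∧
    ∀ {η δ₁ δ₂ : ℝ} {w s : ℝ → ℝ} {u : EuclideanSpace ℝ (Fin n) → ℝ},
    WHyp n η δ₁ δ₂ w s u → ∀ {G : ℝ}, 0 < G →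
    (∫⁻ x in Metric.ball (0 : EuclideanSpace ℝ (Fin n)) η,
      Gd p w u x * ENNReal.ofReal (‖x‖ ^ (1 - (n:ℝ)))) ≤ ENNReal.ofReal G →
    (∫⁻ x in Metric.ball (0 : EuclideanSpace ℝ (Fin n)) η,
      Rd p q w s u x * ENNReal.ofReal (‖x‖ ^ (1 - (n:ℝ)))) ≤ ENNReal.ofReal (C * G ^ (q/p)) := by
  rcases hn.eq_or_lt with rfl | hn'
  · exact core_one hp hpq
  · exact core_two hn' hp hpq h2

lemma radii (hη : 0 < η) (hc : HasCompactSupport u) (hs : tsupport u ⊆ Metric.ball 0 η \ {0}) :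
    ∃ δ₁ δ₂ : ℝ, 0 < δ₁ ∧ δ₁ ≤ δ₂ ∧ δ₂ < η ∧ (∀ x, ‖x‖ ≤ δ₁ → u x = 0) ∧ ∀ x, δ₂ ≤ ‖x‖ → u x = 0 := by
  rcases (tsupport u).eq_empty_or_nonempty with he | hne
  · have hz : ∀ x, u x = 0 := fun x => image_eq_zero_of_notMem_tsupport (by rw [he]; simp)
    exact ⟨η/3, η/2, by linarith, by linarith, by linarith, fun x _ => hz x, fun x _ => hz x⟩
  · obtain ⟨x1, hx1, hm1⟩ := IsCompact.exists_isMinOn hc hne continuous_norm.continuousOn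
    obtain ⟨x2, hx2, hm2⟩ := IsCompact.exists_isMaxOn hc hne continuous_norm.continuousOn
    have a1 : 0 < ‖x1‖ := norm_pos_iff.2 (by simpa using (hs hx1).2)
    have a2 : ‖x2‖ < η := by simpa using (hs hx2).1
    have a3 : ‖x1‖ ≤ ‖x2‖ := hm1 hx2
    refine ⟨‖x1‖/2, (‖x2‖ + η)/2, by linarith, by linarith, by linarith, fun x hx => ?_, fun x hx => ?_⟩
    · refine image_eq_zero_of_notMem_tsupport fun h => ?_
      have : ‖x1‖ ≤ ‖x‖ := hm1 h
      linarith
    · refine image_eq_zero_of_notMem_tsupport fun h => ?_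
      have : ‖x‖ ≤ ‖x2‖ := hm2 h
      linarith

lemma whyp_of {a : ℝ} (ha : 1 < a) (k : ℕ) (hu : ContDiff ℝ 1 u)
    (d1 : 0 < δ₁) (d12 : δ₁ ≤ δ₂) (d2 : δ₂ < η) (u1 : ∀ x, ‖x‖ ≤ δ₁ → u x = 0)
    (u2 : ∀ x, δ₂ ≤ ‖x‖ → u x = 0) :
    ∃ w s : ℝ → ℝ, WHyp n η δ₁ δ₂ w s u ∧ (∀ t ∈ Ioo 0 η, w t = wsl a k 1 η t) ∧
      (∀ t ∈ Ioo 0 η, s t = A1 a (k+1) (η / t)) := by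
  classical
  have hsd : ∀ t ∈ Ioo 0 η, HasDerivAt (fun t => A1 a (k+1) (η/t)) (-1 / wsl a k 1 η t) t :=
    fun t ht => s_deriv ha k ht.1 ht.2
  obtain ⟨w, hw⟩ : ∃ w, w = (Ioo 0 η).piecewise (wsl a k 1 η) (fun _ => 0) := ⟨_, rfl⟩
  obtain ⟨s, hs⟩ : ∃ s, s = (Ioo 0 η).piecewise (fun t => A1 a (k+1) (η/t)) (fun _ => 0) := ⟨_, rfl⟩
  have ew : ∀ t ∈ Ioo 0 η, w t = wsl a k 1 η t := fun t ht => by rw [hw, piecewise_eq_of_mem _ _ _ ht]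
  have es : ∀ t ∈ Ioo 0 η, s t = A1 a (k+1) (η / t) := fun t ht => by rw [hs, piecewise_eq_of_mem _ _ _ ht]
  refine ⟨w, s, ⟨d1, d12, d2, ?_, ?_, ?_, ?_, ?_, ?_, hu, u1, u2⟩, ew, es⟩
  · rw [hw]; exact (wsl_cont ha k).measurable_piecewise continuousOn_const measurableSet_Ioo
  · rw [hs]
    exact ContinuousOn.measurable_piecewise (fun t ht => (hsd t ht).continuousAt.continuousWithinAt)
      continuousOn_const measurableSet_Ioo
  · exact (wsl_cont ha k).congr ew
  · intro t ht; rw [ew t ht]; exact wsl_ge ha k ht.1 ht.2.le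
  · intro t ht
    rw [ew t ht]
    refine (hsd t ht).congr_of_eventuallyEq ?_
    filter_upwards [isOpen_Ioo.mem_nhds ht] with y hy using es y hy
  · intro t ht
    rw [es t ht]
    have : 1 ≤ η / t := by rw [le_div_iff₀ ht.1]; linarith [ht.2]
    exact ha.le.trans (A1_ge ha _ this)

lemma lhs_integrable {a : ℝ} (ha : 1 < a) (k : ℕ) {p : ℝ} (hp : 1 < p) (hu : ContDiff ℝ 1 u)
    (hc : HasCompactSupport u) (hs : tsupport u ⊆ Metric.ball 0 η \ {0}) :
    Integrable (fun x => ‖fderiv ℝ u x‖ ^ p * (wsl a k 1 η ‖x‖) ^ (p - 1) * ‖x‖ ^ (1 - (n : ℝ))) := by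
  have hin : ∀ x ∈ tsupport u, ‖x‖ ∈ Ioo 0 η := fun x hx =>
    ⟨norm_pos_iff.2 (by simpa using (hs hx).2), by simpa using (hs hx).1⟩
  have hcf : Continuous (fun x => ‖fderiv ℝ u x‖ ^ p) :=
    (hu.continuous_fderiv (by norm_num)).norm.rpow_const fun x => Or.inr (by linarith)
  have hw : ContinuousOn (fun x : EuclideanSpace ℝ (Fin n) => wsl a k 1 η ‖x‖) (tsupport u) :=
    (wsl_cont ha k).comp continuous_norm.continuousOn hin
  have hco : ContinuousOn (fun x => ‖fderiv ℝ u x‖ ^ p * (wsl a k 1 η ‖x‖) ^ (p - 1) * ‖x‖ ^ (1 - (n : ℝ)))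
      (tsupport u) := by
    refine (hcf.continuousOn.mul (hw.rpow_const fun x hx => Or.inr (by linarith))).mul
      (continuous_norm.continuousOn.rpow_const fun x hx => Or.inl (hin x hx).1.ne')
  have hi := hco.integrableOn_compact (μ := volume) hc
  rwa [integrableOn_iff_integrable_of_support_subset] at hi
  intro x hx
  by_contra h
  apply hx
  have : fderiv ℝ u x = 0 := by
    by_contra h'
    exact h (support_fderiv_subset ℝ h')
  simp only [this, norm_zero]
  rw [Real.zero_rpow (by linarith)]; simp

end Assembly

/-- Critical CKN-type inequality with super-logarithmic weights, `α = 1`: for `n ≥ 1`,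
`k ∈ ℕ∪{0}`, `1 < p ≤ q < ∞` with `0 ≤ 1/p − 1/q ≤ 1/n`, `η > 0` and `a > 1`, there is
`C > 0` such that for all `u ∈ C_c^∞(B_η∖{0})`,
`∫_{B_η} |∇u|^p w^{sl}_{k,1}(|x|)^{p−1} |x|^{1−n} ≥
 C (∫_{B_η} |u|^q |x|^{1−n} / (w^{sl}_{k,1}(|x|)·A^1_{k+1}(η/|x|)^{1+q/p'}))^{p/q}`. -/
theorem stmt18 (a : ℝ) (ha : 1 < a) (n k : ℕ) (hn : 1 ≤ n) (p q : ℝ) (hp : 1 < p)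
    (hpq : p ≤ q) (h1 : 0 ≤ 1 / p - 1 / q) (h2 : 1 / p - 1 / q ≤ 1 / (n : ℝ))
    (η : ℝ) (hη : 0 < η) :
    ∃ C : ℝ, 0 < C ∧ ∀ u : EuclideanSpace ℝ (Fin n) → ℝ,
      ContDiff ℝ (⊤ : ℕ∞) u → HasCompactSupport u →
      tsupport u ⊆ Metric.ball 0 η \ {0} →
      ∫ x in Metric.ball (0 : EuclideanSpace ℝ (Fin n)) η,
          ‖fderiv ℝ u x‖ ^ p * (wsl a k 1 η ‖x‖) ^ (p - 1) * ‖x‖ ^ (1 - (n : ℝ)) ≥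
        C * (∫ x in Metric.ball (0 : EuclideanSpace ℝ (Fin n)) η,
            |u x| ^ q * ‖x‖ ^ (1 - (n : ℝ)) /
              (wsl a k 1 η ‖x‖ *
                (A1 a (k + 1) (η / ‖x‖)) ^ (1 + q / (p / (p - 1))))) ^ (p / q) := by
  obtain ⟨C, hC, hcore⟩ := core (n := n) hn hp hpq h2
  have hq : 0 < q := by linarith
  have hp0 : 0 < p := by linarith
  refine ⟨(C ^ (p/q))⁻¹, by positivity, ?_⟩
  intro u hu hc hs
  have hu1 : ContDiff ℝ 1 u := hu.of_le (by exact_mod_cast le_top)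
  obtain ⟨δ₁, δ₂, d1, d12, d2, u1, u2⟩ := radii hη hc hs
  obtain ⟨w, s, H, ew, es⟩ := whyp_of ha k hu1 d1 d12 d2 u1 u2
  have hi := lhs_integrable ha k hp hu1 hc hs
  obtain ⟨f, hf⟩ : ∃ f : EuclideanSpace ℝ (Fin n) → ℝ, f = fun x =>
    ‖fderiv ℝ u x‖ ^ p * (wsl a k 1 η ‖x‖) ^ (p - 1) * ‖x‖ ^ (1 - (n : ℝ)) := ⟨_, rfl⟩
  obtain ⟨g, hg⟩ : ∃ g : EuclideanSpace ℝ (Fin n) → ℝ, g = fun x =>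
    |u x| ^ q * ‖x‖ ^ (1 - (n : ℝ)) /
      (wsl a k 1 η ‖x‖ * (A1 a (k + 1) (η / ‖x‖)) ^ (1 + q / (p / (p - 1)))) := ⟨_, rfl⟩
  rw [← hf] at hi ⊢
  rw [← hg]
  have hIoo : ∀ x ∈ Metric.ball (0 : EuclideanSpace ℝ (Fin n)) η, x ≠ 0 → ‖x‖ ∈ Ioo 0 η :=
    fun x hx h0 => ⟨norm_pos_iff.2 h0, by simpa using hx⟩
  have efg : ∀ x ∈ Metric.ball (0 : EuclideanSpace ℝ (Fin n)) η,
      0 ≤ f x ∧ ENNReal.ofReal (f x) = Gd p w u x * ENNReal.ofReal (‖x‖ ^ (1 - (n:ℝ))) := by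
    intro x hx
    rcases eq_or_ne x 0 with rfl | h0
    · have : fderiv ℝ u 0 = 0 := fderiv_zero_out H (Or.inl (by simpa using d1))
      simp [hf, Gd, this, Real.zero_rpow hp0.ne']
    · have hm := hIoo x hx h0
      have hw := H.wge _ hm
      have hw0 : 0 < w ‖x‖ := hm.1.trans_le hw
      rw [hf, Gd, ← ENNReal.ofReal_mul (by positivity)]
      simp only [← ew _ hm]
      exact ⟨by positivity, trivial⟩
  have egg : ∀ x ∈ Metric.ball (0 : EuclideanSpace ℝ (Fin n)) η,
      0 ≤ g x ∧ ENNReal.ofReal (g x) = Rd p q w s u x * ENNReal.ofReal (‖x‖ ^ (1 - (n:ℝ))) := by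
    intro x hx
    rcases eq_or_ne x 0 with rfl | h0
    · have : u 0 = 0 := u1 0 (by simpa using d1.le)
      simp [hg, Rd, this, Real.zero_rpow hq.ne']
    · have hm := hIoo x hx h0
      have hw := H.wge _ hm
      have hw0 : 0 < w ‖x‖ := hm.1.trans_le hw
      have hs0 : 0 < s ‖x‖ := by linarith [H.s1 _ hm]
      rw [hg, Rd, ← ENNReal.ofReal_mul (by positivity)]
      simp only [← ew _ hm, ← es _ hm]
      refine ⟨by positivity, ?_⟩
      congr 1; ring
  have hb : MeasurableSet (Metric.ball (0 : EuclideanSpace ℝ (Fin n)) η) := Metric.isOpen_ball.measurableSet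
  obtain ⟨L, hL⟩ : ∃ L, L = ∫ x in Metric.ball (0 : EuclideanSpace ℝ (Fin n)) η, f x := ⟨_, rfl⟩
  obtain ⟨R, hR⟩ : ∃ R, R = ∫ x in Metric.ball (0 : EuclideanSpace ℝ (Fin n)) η, g x := ⟨_, rfl⟩
  have hL0 : 0 ≤ L := by rw [hL]; exact setIntegral_nonneg hb fun x hx => (efg x hx).1
  have hR0 : 0 ≤ R := by rw [hR]; exact setIntegral_nonneg hb fun x hx => (egg x hx).1
  have hLe : ∫⁻ x in Metric.ball (0 : EuclideanSpace ℝ (Fin n)) η,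
      Gd p w u x * ENNReal.ofReal (‖x‖ ^ (1 - (n:ℝ))) = ENNReal.ofReal L := by
    rw [hL, ofReal_integral_eq_lintegral_ofReal hi.integrableOn
      ((ae_restrict_iff' hb).2 (ae_of_all _ fun x hx => (efg x hx).1))]
    exact setLIntegral_congr_fun hb fun x hx => (efg x hx).2.symm
  have hRe : ENNReal.ofReal R ≤ ∫⁻ x in Metric.ball (0 : EuclideanSpace ℝ (Fin n)) η,
      Rd p q w s u x * ENNReal.ofReal (‖x‖ ^ (1 - (n:ℝ))) := by
    have h := enorm_integral_le_lintegral_enorm (μ := volume.restrict (Metric.ball (0 : EuclideanSpace ℝ (Fin n)) η)) g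
    rw [← hR, Real.enorm_eq_ofReal hR0] at h
    refine h.trans (le_of_eq (setLIntegral_congr_fun hb fun x hx => ?_))
    simp only [Real.enorm_eq_ofReal (egg x hx).1, (egg x hx).2]
  have key : ∀ ε > 0, R ^ (p/q) ≤ C ^ (p/q) * (L + ε) := by
    intro ε hε
    have h1 := hRe.trans (hcore H (G := L + ε) (by linarith)
      (hLe.le.trans (ENNReal.ofReal_le_ofReal (by linarith))))
    have hLε : 0 < L + ε := by linarith
    rw [ENNReal.ofReal_le_ofReal_iff (by positivity)] at h1
    have h3 := Real.rpow_le_rpow hR0 h1 (show 0 ≤ p/q by positivity)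
    rw [Real.mul_rpow hC.le (by positivity), ← Real.rpow_mul hLε.le] at h3
    have e : q / p * (p / q) = 1 := by field_simp
    rwa [e, Real.rpow_one] at h3
  rw [← hL, ← hR, ge_iff_le]
  have hCp : 0 < C ^ (p/q) := by positivity
  refine le_of_forall_pos_le_add fun ε hε => ?_
  rw [inv_mul_le_iff₀ hCp]
  exact key ε hε
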